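/- arXiv:1507.00698 — 3 statements merged into one kernel-verified Lean document; each statement's English description precedes it below -/
import Mathlib

section
/- Each circle C_k is a limit cycle of the vector field X_{Tm}, and its interior stability equals (−1)^{m_k + M_k + 1}, where M_k := Σ_{j ≠ k, C_k ⊆ D_{C_j}} m_j; that is, C_k is stable in the interior if m_k + M_k is even and unstable in the interior if m_k + M_k is odd. -/
open MvPolynomial Function Set Filter Real
open scoped Classical

noncomputable section

/-- Bivariate real polynomials, representing components of planar polynomial vector fields. -/
abbrev Poly2 := MvPolynomial (Fin 2) ℝ

/-- Evaluation of a bivariate polynomial at a point of the plane. -/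
def pev (P : Poly2) (p : ℝ × ℝ) : ℝ := MvPolynomial.eval ![p.1, p.2] P

/-- The circle polynomial `f(x,y) = (x−a)² + (y−b)² − ρ²`. -/
def fpoly (c : ℝ × ℝ) (ρ : ℝ) : Poly2 :=
  (X 0 - MvPolynomial.C c.1) ^ 2 + (X 1 - MvPolynomial.C c.2) ^ 2 - MvPolynomial.C (ρ ^ 2)

/-- The divergence `∂P/∂x + ∂Q/∂y` of the vector field `X = P ∂ₓ + Q ∂ᵧ`. -/
def divPoly (P Q : Poly2) : Poly2 := pderiv 0 P + pderiv 1 Q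

/-- `γ : ℝ → ℝ²` is a (C¹) solution of the vector field `X = P ∂ₓ + Q ∂ᵧ`. -/
def IsSolution (P Q : Poly2) (γ : ℝ → ℝ × ℝ) : Prop :=
  ∀ t, HasDerivAt γ (pev P (γ t), pev Q (γ t)) t

/-- `S` is a periodic orbit of `X = P ∂ₓ + Q ∂ᵧ`: the image of a nonconstant periodic solution. -/
def IsPeriodicOrbit (P Q : Poly2) (S : Set (ℝ × ℝ)) : Prop :=
  ∃ γ : ℝ → ℝ × ℝ, ∃ T : ℝ, 0 < T ∧ IsSolution P Q γ ∧ Function.Periodic γ T ∧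
    (∃ t₀ t₁, γ t₀ ≠ γ t₁) ∧ Set.range γ = S

/-- `S` is a limit cycle: a periodic orbit with a neighborhood meeting no other periodic orbit. -/
def IsLimitCycle (P Q : Poly2) (S : Set (ℝ × ℝ)) : Prop :=
  IsPeriodicOrbit P Q S ∧
  ∃ U : Set (ℝ × ℝ), IsOpen U ∧ S ⊆ U ∧
    ∀ S', IsPeriodicOrbit P Q S' → S' ≠ S → Disjoint S' U

/-- `T` is the least positive period of `γ`. -/
def IsLeastPeriod (γ : ℝ → ℝ × ℝ) (T : ℝ) : Prop :=
  0 < T ∧ Function.Periodic γ T ∧ ∀ T', 0 < T' → Function.Periodic γ T' → T ≤ T'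

/-- The (limit) cycle `S` has least period `T`: it is parametrized by a solution of least
period `T`. -/
def HasLeastPeriodCycle (P Q : Poly2) (S : Set (ℝ × ℝ)) (T : ℝ) : Prop :=
  ∃ γ : ℝ → ℝ × ℝ, IsSolution P Q γ ∧ Set.range γ = S ∧ IsLeastPeriod γ T

/-- `V` is a (polynomial) inverse integrating factor of `X = P ∂ₓ + Q ∂ᵧ`:
`P ∂V/∂x + Q ∂V/∂y = V (∂P/∂x + ∂Q/∂y)`. -/
def IsInvFactor (P Q V : Poly2) : Prop :=
  P * pderiv 0 V + Q * pderiv 1 V = V * divPoly P Q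

/-- An embedded closed curve in the plane: a set homeomorphic to the circle. -/
def IsCycle (S : Set (ℝ × ℝ)) : Prop :=
  Nonempty (S ≃ₜ Metric.sphere (0 : ℝ × ℝ) 1)

/-- The compact region `D_C` bounded by a closed curve `C`: the curve together with the
points of the complement whose connected component in the complement is bounded. -/
def encDisk (S : Set (ℝ × ℝ)) : Set (ℝ × ℝ) :=
  S ∪ {p | p ∉ S ∧ Bornology.IsBounded (connectedComponentIn Sᶜ p)}

/-- `C_k` is a primary cycle of the configuration `Γ`: no other `C_j` is contained in `D_{C_k}`. -/
def PrimaryCycle {n : ℕ} (Γ : Fin n → Set (ℝ × ℝ)) (k : Fin n) : Prop :=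
  ∀ j, j ≠ k → ¬ Γ j ⊆ encDisk (Γ k)

/-- The limit cycle `S`, with enclosed region `D`, is stable in the interior for
`X = P ∂ₓ + Q ∂ᵧ`: every solution starting in the bounded region enclosed by `S`
sufficiently close to `S` converges to `S` as `t → +∞`. -/
def InteriorStable (P Q : Poly2) (S D : Set (ℝ × ℝ)) : Prop :=
  ∃ U : Set (ℝ × ℝ), IsOpen U ∧ S ⊆ U ∧
    ∀ γ : ℝ → ℝ × ℝ, IsSolution P Q γ → γ 0 ∈ (D \ S) ∩ U →
      Filter.Tendsto (fun t => Metric.infDist (γ t) S) Filter.atTop (nhds 0)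

/-- The limit cycle `S`, with enclosed region `D`, is unstable in the interior:
every solution starting in the bounded region enclosed by `S` sufficiently close to `S`
converges to `S` as `t → −∞`. -/
def InteriorUnstable (P Q : Poly2) (S D : Set (ℝ × ℝ)) : Prop :=
  ∃ U : Set (ℝ × ℝ), IsOpen U ∧ S ⊆ U ∧
    ∀ γ : ℝ → ℝ × ℝ, IsSolution P Q γ → γ 0 ∈ (D \ S) ∩ U →
      Filter.Tendsto (fun t => Metric.infDist (γ t) S) Filter.atBot (nhds 0)

/-- The polynomial `g(x,y) = (x−a)² + (y−b)²`. -/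
def gpoly (c : ℝ × ℝ) : Poly2 :=
  (X 0 - MvPolynomial.C c.1) ^ 2 + (X 1 - MvPolynomial.C c.2) ^ 2

variable {n : ℕ}

/-- `f_k(x,y) = (x−x_k)² + (y−y_k)² − r_k²`. -/
def fk (ctr : Fin n → ℝ × ℝ) (rad : Fin n → ℝ) (k : Fin n) : Poly2 :=
  fpoly (ctr k) (rad k)

/-- The circle `C_k = f_k⁻¹(0)`. -/
def Ccir (ctr : Fin n → ℝ × ℝ) (rad : Fin n → ℝ) (k : Fin n) : Set (ℝ × ℝ) :=
  {p : ℝ × ℝ | pev (fk ctr rad k) p = 0}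

/-- The closed disc `D_{C_k}` bounded by the circle `C_k`. -/
def Ddisc (ctr : Fin n → ℝ × ℝ) (rad : Fin n → ℝ) (k : Fin n) : Set (ℝ × ℝ) :=
  {p : ℝ × ℝ | (p.1 - (ctr k).1) ^ 2 + (p.2 - (ctr k).2) ^ 2 ≤ (rad k) ^ 2}

/-- `C_k` is primary: no other circle `C_j` is contained in `D_{C_k}`. -/
def Primary (ctr : Fin n → ℝ × ℝ) (rad : Fin n → ℝ) (k : Fin n) : Prop :=
  ∀ j, j ≠ k → ¬ Ccir ctr rad j ⊆ Ddisc ctr rad k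

/-- `A = ∏_{k=1}^n f_k`. -/
def Apoly (ctr : Fin n → ℝ × ℝ) (rad : Fin n → ℝ) : Poly2 := ∏ k, fk ctr rad k

/-- `B = ∏_{k=1}^r g_k` (product over the primary indices, i.e. those with `k < r`). -/
def Bpoly (r : ℕ) (ctr : Fin n → ℝ × ℝ) : Poly2 :=
  ∏ k ∈ Finset.univ.filter (fun k : Fin n => (k : ℕ) < r), gpoly (ctr k)

/-- `μ_k = ∏_{j≠k} f_j`. -/
def muk (ctr : Fin n → ℝ × ℝ) (rad : Fin n → ℝ) (k : Fin n) : Poly2 :=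
  ∏ j ∈ Finset.univ.erase k, fk ctr rad j

/-- `P_T = A(∂B/∂x − ∂B/∂y) − B Σ_k τ_k μ_k ∂f_k/∂y`. -/
def PT (r : ℕ) (ctr : Fin n → ℝ × ℝ) (rad τ : Fin n → ℝ) : Poly2 :=
  Apoly ctr rad * (pderiv 0 (Bpoly r ctr) - pderiv 1 (Bpoly r ctr)) -
    Bpoly r ctr * ∑ k, MvPolynomial.C (τ k) * muk ctr rad k * pderiv 1 (fk ctr rad k)

/-- `Q_T = A(∂B/∂x + ∂B/∂y) + B Σ_k τ_k μ_k ∂f_k/∂x`. -/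
def QT (r : ℕ) (ctr : Fin n → ℝ × ℝ) (rad τ : Fin n → ℝ) : Poly2 :=
  Apoly ctr rad * (pderiv 0 (Bpoly r ctr) + pderiv 1 (Bpoly r ctr)) +
    Bpoly r ctr * ∑ k, MvPolynomial.C (τ k) * muk ctr rad k * pderiv 0 (fk ctr rad k)

/-- `N_k`: the number of circles `C_j`, `j ≠ k`, whose bounded disc contains `C_k`. -/
def Nk (ctr : Fin n → ℝ × ℝ) (rad : Fin n → ℝ) (k : Fin n) : ℕ :=
  Nat.card {j : Fin n // j ≠ k ∧ Ccir ctr rad k ⊆ Ddisc ctr rad j}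

/-- `s_k`: the number of primary circles contained in the closed disc `D_{C_k}`. -/
def sk (r : ℕ) (ctr : Fin n → ℝ × ℝ) (rad : Fin n → ℝ) (k : Fin n) : ℕ :=
  Nat.card {j : Fin n // (j : ℕ) < r ∧ Ccir ctr rad j ⊆ Ddisc ctr rad k}

/-- `λ_k = ∏_{j≠k} f_j^{m_j}`. -/
def lamk (ctr : Fin n → ℝ × ℝ) (rad : Fin n → ℝ) (m : Fin n → ℕ) (k : Fin n) : Poly2 :=
  ∏ j ∈ Finset.univ.erase k, fk ctr rad j ^ m j

/-- `Λ = Σ_k (m_k − 1)`. -/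
def Lam (m : Fin n → ℕ) : ℕ := ∑ k, (m k - 1)

/-- `A_m = ∏_k f_k^{m_k}`. -/
def Am (ctr : Fin n → ℝ × ℝ) (rad : Fin n → ℝ) (m : Fin n → ℕ) : Poly2 :=
  ∏ k, fk ctr rad k ^ m k

/-- `F_T = Λ Σ_k τ_k λ_k ∂f_k/∂y`. -/
def FTm (ctr : Fin n → ℝ × ℝ) (rad τ : Fin n → ℝ) (m : Fin n → ℕ) : Poly2 :=
  MvPolynomial.C ((Lam m : ℕ) : ℝ) *
    ∑ k, MvPolynomial.C (τ k) * lamk ctr rad m k * pderiv 1 (fk ctr rad k)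

/-- `G_T = Λ Σ_k τ_k λ_k ∂f_k/∂x`. -/
def GTm (ctr : Fin n → ℝ × ℝ) (rad τ : Fin n → ℝ) (m : Fin n → ℕ) : Poly2 :=
  MvPolynomial.C ((Lam m : ℕ) : ℝ) *
    ∑ k, MvPolynomial.C (τ k) * lamk ctr rad m k * pderiv 0 (fk ctr rad k)

/-- `P_{Tm} = P_T · ∏_k f_k^{m_k−1} − B F_T`. -/
def PTm (r : ℕ) (ctr : Fin n → ℝ × ℝ) (rad τ : Fin n → ℝ) (m : Fin n → ℕ) : Poly2 :=
  PT r ctr rad τ * ∏ k, fk ctr rad k ^ (m k - 1) - Bpoly r ctr * FTm ctr rad τ m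

/-- `Q_{Tm} = Q_T · ∏_k f_k^{m_k−1} + B G_T`. -/
def QTm (r : ℕ) (ctr : Fin n → ℝ × ℝ) (rad τ : Fin n → ℝ) (m : Fin n → ℕ) : Poly2 :=
  QT r ctr rad τ * ∏ k, fk ctr rad k ^ (m k - 1) + Bpoly r ctr * GTm ctr rad τ m

/-- `M_k = Σ_{j ≠ k, C_k ⊆ D_{C_j}} m_j`. -/
def Mk (ctr : Fin n → ℝ × ℝ) (rad : Fin n → ℝ) (m : Fin n → ℕ) (k : Fin n) : ℕ :=
  ∑ j ∈ Finset.univ.filter (fun j : Fin n => j ≠ k ∧ Ccir ctr rad k ⊆ Ddisc ctr rad j), m j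

theorem pev_add (P Q : Poly2) (p : ℝ × ℝ) : pev (P + Q) p = pev P p + pev Q p := map_add _ _ _
theorem pev_sub (P Q : Poly2) (p : ℝ × ℝ) : pev (P - Q) p = pev P p - pev Q p := map_sub _ _ _
theorem pev_mul (P Q : Poly2) (p : ℝ × ℝ) : pev (P * Q) p = pev P p * pev Q p := map_mul _ _ _
theorem pev_pow (P : Poly2) (k : ℕ) (p : ℝ × ℝ) : pev (P ^ k) p = pev P p ^ k := map_pow _ _ _
theorem pev_C (a : ℝ) (p : ℝ × ℝ) : pev (MvPolynomial.C a) p = a := by simp [pev]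
theorem pev_sum {ι : Type*} (s : Finset ι) (P : ι → Poly2) (p : ℝ × ℝ) :
    pev (∑ i ∈ s, P i) p = ∑ i ∈ s, pev (P i) p := map_sum _ _ _
theorem pev_prod {ι : Type*} (s : Finset ι) (P : ι → Poly2) (p : ℝ × ℝ) :
    pev (∏ i ∈ s, P i) p = ∏ i ∈ s, pev (P i) p := map_prod _ _ _

theorem contDiff_pev (P : Poly2) : ContDiff ℝ 1 (pev P) := by
  induction P using MvPolynomial.induction_on with
  | C a => simpa only [funext (pev_C a)] using contDiff_const
  | add p q hp hq => simpa only [funext (pev_add p q)] using hp.add hq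
  | mul_X p i hp =>
    rw [funext (pev_mul p (X i))]
    refine hp.mul ?_
    fin_cases i
    · have : pev (X 0) = Prod.fst := by ext p; simp [pev]
      change ContDiff ℝ 1 (pev (X 0))
      rw [this]
      exact contDiff_fst
    · have : pev (X 1) = Prod.snd := by ext p; simp [pev]
      change ContDiff ℝ 1 (pev (X 1))
      rw [this]
      exact contDiff_snd

theorem continuous_pev (P : Poly2) : Continuous (pev P) := (contDiff_pev P).continuous

theorem pev_gpoly (c p : ℝ × ℝ) : pev (gpoly c) p = (p.1 - c.1) ^ 2 + (p.2 - c.2) ^ 2 := by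
  simp [pev, gpoly]

theorem pev_fk (ctr : Fin n → ℝ × ℝ) (rad : Fin n → ℝ) (k : Fin n) (p : ℝ × ℝ) :
    pev (fk ctr rad k) p =
      (p.1 - (ctr k).1) ^ 2 + (p.2 - (ctr k).2) ^ 2 - rad k ^ 2 := by
  simp [pev, fk, fpoly]

theorem pev_pderiv_zero_gpoly (c p : ℝ × ℝ) :
    pev (pderiv 0 (gpoly c)) p = 2 * (p.1 - c.1) := by
  simp [pev, gpoly, pderiv_X]

theorem pev_pderiv_one_gpoly (c p : ℝ × ℝ) :
    pev (pderiv 1 (gpoly c)) p = 2 * (p.2 - c.2) := by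
  simp [pev, gpoly, pderiv_X]

theorem pev_pderiv_zero_fk (ctr : Fin n → ℝ × ℝ) (rad : Fin n → ℝ) (k : Fin n) (p : ℝ × ℝ) :
    pev (pderiv 0 (fk ctr rad k)) p = 2 * (p.1 - (ctr k).1) := by
  simp [pev, fk, fpoly, pderiv_X]

theorem pev_pderiv_one_fk (ctr : Fin n → ℝ × ℝ) (rad : Fin n → ℝ) (k : Fin n) (p : ℝ × ℝ) :
    pev (pderiv 1 (fk ctr rad k)) p = 2 * (p.2 - (ctr k).2) := by
  simp [pev, fk, fpoly, pderiv_X]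

theorem pev_pderiv_prod {ι : Type*} (s : Finset ι) (g : ι → Poly2) (i : Fin 2) (p : ℝ × ℝ)
    (h : ∀ j ∈ s, pev (g j) p ≠ 0) :
    pev (pderiv i (∏ j ∈ s, g j)) p =
      pev (∏ j ∈ s, g j) p * ∑ j ∈ s, pev (pderiv i (g j)) p / pev (g j) p := by
  induction s using Finset.induction_on with
  | empty => simp [pev]
  | insert a s ha ih =>
    have h1 := h a (Finset.mem_insert_self a s)
    have h2 := ih fun j hj => h j (Finset.mem_insert_of_mem hj)
    rw [Finset.prod_insert ha, Finset.sum_insert ha, Derivation.leibniz, pev_add, smul_eq_mul,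
      smul_eq_mul, pev_mul, pev_mul, h2, pev_mul]
    field_simp
    ring

theorem prod_erase_mul_prod_pow (F : Fin n → ℝ) (m : Fin n → ℕ) (hm : ∀ k, 1 ≤ m k) (j : Fin n) :
    (∏ i ∈ Finset.univ.erase j, F i) * ∏ i, F i ^ (m i - 1) =
      (∏ i ∈ Finset.univ.erase j, F i ^ m i) * F j ^ (m j - 1) := by
  rw [← Finset.prod_erase_mul Finset.univ (fun i => F i ^ (m i - 1)) (Finset.mem_univ j),
    ← mul_assoc, ← Finset.prod_mul_distrib]
  congr 1
  refine Finset.prod_congr rfl fun i _ => ?_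
  rw [← pow_succ', Nat.sub_add_cancel (hm i)]

theorem prod_mul_prod_pow (F : Fin n → ℝ) (m : Fin n → ℕ) (hm : ∀ k, 1 ≤ m k) :
    (∏ i, F i) * ∏ i, F i ^ (m i - 1) = ∏ i, F i ^ m i := by
  rw [← Finset.prod_mul_distrib]
  refine Finset.prod_congr rfl fun i _ => ?_
  rw [← pow_succ', Nat.sub_add_cancel (hm i)]

theorem pev_PTm (r : ℕ) (ctr : Fin n → ℝ × ℝ) (rad τ : Fin n → ℝ) (m : Fin n → ℕ)
    (hm : ∀ k, 1 ≤ m k) (p : ℝ × ℝ) :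
    pev (PTm r ctr rad τ m) p = (∏ j, pev (fk ctr rad j) p ^ m j) *
        (pev (pderiv 0 (Bpoly r ctr)) p - pev (pderiv 1 (Bpoly r ctr)) p) -
      pev (Bpoly r ctr) p * ∑ j, τ j * (∏ i ∈ Finset.univ.erase j, pev (fk ctr rad i) p ^ m i) *
        (pev (fk ctr rad j) p ^ (m j - 1) + Lam m) * (2 * (p.2 - (ctr j).2)) := by
  simp only [PTm, PT, FTm, Apoly, muk, lamk, pev_sub, pev_mul, pev_prod, pev_sum, pev_C, pev_pow,
    pev_pderiv_one_fk]
  set F := fun j => pev (fk ctr rad j) p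
  have h1 := prod_mul_prod_pow F m hm
  have h2 : ∑ j, τ j * (∏ i ∈ Finset.univ.erase j, F i ^ m i) *
        (F j ^ (m j - 1) + Lam m) * (2 * (p.2 - (ctr j).2)) =
      (∑ j, τ j * (∏ i ∈ Finset.univ.erase j, F i) * (2 * (p.2 - (ctr j).2))) *
        ∏ i, F i ^ (m i - 1) +
      Lam m * ∑ j, τ j * (∏ i ∈ Finset.univ.erase j, F i ^ m i) * (2 * (p.2 - (ctr j).2)) := by
    rw [Finset.sum_mul, Finset.mul_sum, ← Finset.sum_add_distrib]
    refine Finset.sum_congr rfl fun j _ => ?_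
    linear_combination (-τ j * (2 * (p.2 - (ctr j).2))) * prod_erase_mul_prod_pow F m hm j
  simp only [F] at h1 h2
  rw [h2, ← h1]
  ring

theorem pev_QTm (r : ℕ) (ctr : Fin n → ℝ × ℝ) (rad τ : Fin n → ℝ) (m : Fin n → ℕ)
    (hm : ∀ k, 1 ≤ m k) (p : ℝ × ℝ) :
    pev (QTm r ctr rad τ m) p = (∏ j, pev (fk ctr rad j) p ^ m j) *
        (pev (pderiv 0 (Bpoly r ctr)) p + pev (pderiv 1 (Bpoly r ctr)) p) +
      pev (Bpoly r ctr) p * ∑ j, τ j * (∏ i ∈ Finset.univ.erase j, pev (fk ctr rad i) p ^ m i) *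
        (pev (fk ctr rad j) p ^ (m j - 1) + Lam m) * (2 * (p.1 - (ctr j).1)) := by
  simp only [QTm, QT, GTm, Apoly, muk, lamk, pev_add, pev_mul, pev_prod, pev_sum, pev_C, pev_pow,
    pev_pderiv_zero_fk]
  set F := fun j => pev (fk ctr rad j) p
  have h1 := prod_mul_prod_pow F m hm
  have h2 : ∑ j, τ j * (∏ i ∈ Finset.univ.erase j, F i ^ m i) *
        (F j ^ (m j - 1) + Lam m) * (2 * (p.1 - (ctr j).1)) =
      (∑ j, τ j * (∏ i ∈ Finset.univ.erase j, F i) * (2 * (p.1 - (ctr j).1))) *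
        ∏ i, F i ^ (m i - 1) +
      Lam m * ∑ j, τ j * (∏ i ∈ Finset.univ.erase j, F i ^ m i) * (2 * (p.1 - (ctr j).1)) := by
    rw [Finset.sum_mul, Finset.mul_sum, ← Finset.sum_add_distrib]
    refine Finset.sum_congr rfl fun j _ => ?_
    linear_combination (-τ j * (2 * (p.1 - (ctr j).1))) * prod_erase_mul_prod_pow F m hm j
  simp only [F] at h1 h2
  rw [h2, ← h1]
  ring

/-- The angular speed of `X_{Tm}` on the circle `C_k`. -/
def angularSpeed (r : ℕ) (ctr : Fin n → ℝ × ℝ) (rad τ : Fin n → ℝ) (m : Fin n → ℕ) (k : Fin n)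
    (p : ℝ × ℝ) : ℝ :=
  2 * pev (Bpoly r ctr) p * τ k * (∏ i ∈ Finset.univ.erase k, pev (fk ctr rad i) p ^ m i) *
    (pev (fk ctr rad k) p ^ (m k - 1) + Lam m)

theorem sum_eq_single_of_factor_eq_zero (F τ c : Fin n → ℝ) (m : Fin n → ℕ) (hm : ∀ k, 1 ≤ m k)
    (k : Fin n) (hF : F k = 0) (d : Fin n → ℝ) :
    ∑ j, τ j * (∏ i ∈ Finset.univ.erase j, F i ^ m i) * c j * d j =
      τ k * (∏ i ∈ Finset.univ.erase k, F i ^ m i) * c k * d k := by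
  refine Finset.sum_eq_single k (fun j _ hj => ?_) (by simp)
  have : ∏ i ∈ Finset.univ.erase j, F i ^ m i = 0 :=
    Finset.prod_eq_zero (Finset.mem_erase.2 ⟨hj.symm, Finset.mem_univ k⟩)
      (by rw [hF, zero_pow (by have := hm k; omega)])
  rw [this]
  ring

theorem pev_PTm_of_mem_Ccir (r : ℕ) (ctr : Fin n → ℝ × ℝ) (rad τ : Fin n → ℝ) (m : Fin n → ℕ)
    (hm : ∀ k, 1 ≤ m k) (k : Fin n) {p : ℝ × ℝ} (hp : p ∈ Ccir ctr rad k) :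
    pev (PTm r ctr rad τ m) p = -(p.2 - (ctr k).2) * angularSpeed r ctr rad τ m k p := by
  have hp' : pev (fk ctr rad k) p = 0 := hp
  rw [pev_PTm r ctr rad τ m hm, sum_eq_single_of_factor_eq_zero (fun j => pev (fk ctr rad j) p) τ
    (fun j => pev (fk ctr rad j) p ^ (m j - 1) + Lam m) m hm k hp'
    (fun j => 2 * (p.2 - (ctr j).2)),
    Finset.prod_eq_zero (Finset.mem_univ k)
      (by rw [hp', zero_pow (by have := hm k; omega)]), angularSpeed]
  ring

theorem pev_QTm_of_mem_Ccir (r : ℕ) (ctr : Fin n → ℝ × ℝ) (rad τ : Fin n → ℝ) (m : Fin n → ℕ)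
    (hm : ∀ k, 1 ≤ m k) (k : Fin n) {p : ℝ × ℝ} (hp : p ∈ Ccir ctr rad k) :
    pev (QTm r ctr rad τ m) p = (p.1 - (ctr k).1) * angularSpeed r ctr rad τ m k p := by
  have hp' : pev (fk ctr rad k) p = 0 := hp
  rw [pev_QTm r ctr rad τ m hm, sum_eq_single_of_factor_eq_zero (fun j => pev (fk ctr rad j) p) τ
    (fun j => pev (fk ctr rad j) p ^ (m j - 1) + Lam m) m hm k hp'
    (fun j => 2 * (p.1 - (ctr j).1)),
    Finset.prod_eq_zero (Finset.mem_univ k)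
      (by rw [hp', zero_pow (by have := hm k; omega)]), angularSpeed]
  ring

theorem prod_erase_pow_mul (F : Fin n → ℝ) (m : Fin n → ℕ) (hm : ∀ k, 1 ≤ m k) (L : ℝ)
    (j : Fin n) (hF : F j ≠ 0) :
    (∏ i ∈ Finset.univ.erase j, F i ^ m i) * (F j ^ (m j - 1) + L) =
      (∏ i, F i ^ m i) * (1 / F j + L * (1 / F j ^ m j)) := by
  rw [← Finset.prod_erase_mul Finset.univ (fun i => F i ^ m i) (Finset.mem_univ j)]
  have : F j ^ m j = F j ^ (m j - 1) * F j := by rw [← pow_succ, Nat.sub_add_cancel (hm j)]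
  rw [this]
  field_simp

theorem pev_PTm_of_ne_zero (r : ℕ) (ctr : Fin n → ℝ × ℝ) (rad τ : Fin n → ℝ) (m : Fin n → ℕ)
    (hm : ∀ k, 1 ≤ m k) (p : ℝ × ℝ) (hF : ∀ j, pev (fk ctr rad j) p ≠ 0)
    (hg : ∀ j, pev (gpoly (ctr j)) p ≠ 0) :
    pev (PTm r ctr rad τ m) p = pev (Bpoly r ctr) p * (∏ j, pev (fk ctr rad j) p ^ m j) *
      (∑ j ∈ Finset.univ.filter (fun k : Fin n => (k : ℕ) < r),
          2 * (p.1 - (ctr j).1) / pev (gpoly (ctr j)) p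
        - ∑ j ∈ Finset.univ.filter (fun k : Fin n => (k : ℕ) < r),
          2 * (p.2 - (ctr j).2) / pev (gpoly (ctr j)) p
        - ∑ j, τ j * (1 / pev (fk ctr rad j) p + Lam m * (1 / pev (fk ctr rad j) p ^ m j)) *
          (2 * (p.2 - (ctr j).2))) := by
  have h : ∑ j, τ j * (∏ i ∈ Finset.univ.erase j, pev (fk ctr rad i) p ^ m i) *
        (pev (fk ctr rad j) p ^ (m j - 1) + Lam m) * (2 * (p.2 - (ctr j).2)) =
      (∏ j, pev (fk ctr rad j) p ^ m j) *
        ∑ j, τ j * (1 / pev (fk ctr rad j) p + Lam m * (1 / pev (fk ctr rad j) p ^ m j)) *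
          (2 * (p.2 - (ctr j).2)) := by
    rw [Finset.mul_sum]
    refine Finset.sum_congr rfl fun j _ => ?_
    linear_combination (τ j * (2 * (p.2 - (ctr j).2))) *
      prod_erase_pow_mul (fun i => pev (fk ctr rad i) p) m hm (Lam m) j (hF j)
  rw [pev_PTm r ctr rad τ m hm, h, Bpoly, pev_pderiv_prod _ _ _ _ fun j _ => hg j,
    pev_pderiv_prod _ _ _ _ fun j _ => hg j]
  simp only [pev_pderiv_zero_gpoly, pev_pderiv_one_gpoly]
  ring

theorem pev_QTm_of_ne_zero (r : ℕ) (ctr : Fin n → ℝ × ℝ) (rad τ : Fin n → ℝ) (m : Fin n → ℕ)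
    (hm : ∀ k, 1 ≤ m k) (p : ℝ × ℝ) (hF : ∀ j, pev (fk ctr rad j) p ≠ 0)
    (hg : ∀ j, pev (gpoly (ctr j)) p ≠ 0) :
    pev (QTm r ctr rad τ m) p = pev (Bpoly r ctr) p * (∏ j, pev (fk ctr rad j) p ^ m j) *
      (∑ j ∈ Finset.univ.filter (fun k : Fin n => (k : ℕ) < r),
          2 * (p.1 - (ctr j).1) / pev (gpoly (ctr j)) p
        + ∑ j ∈ Finset.univ.filter (fun k : Fin n => (k : ℕ) < r),
          2 * (p.2 - (ctr j).2) / pev (gpoly (ctr j)) p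
        + ∑ j, τ j * (1 / pev (fk ctr rad j) p + Lam m * (1 / pev (fk ctr rad j) p ^ m j)) *
          (2 * (p.1 - (ctr j).1))) := by
  have h : ∑ j, τ j * (∏ i ∈ Finset.univ.erase j, pev (fk ctr rad i) p ^ m i) *
        (pev (fk ctr rad j) p ^ (m j - 1) + Lam m) * (2 * (p.1 - (ctr j).1)) =
      (∏ j, pev (fk ctr rad j) p ^ m j) *
        ∑ j, τ j * (1 / pev (fk ctr rad j) p + Lam m * (1 / pev (fk ctr rad j) p ^ m j)) *
          (2 * (p.1 - (ctr j).1)) := by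
    rw [Finset.mul_sum]
    refine Finset.sum_congr rfl fun j _ => ?_
    linear_combination (τ j * (2 * (p.1 - (ctr j).1))) *
      prod_erase_pow_mul (fun i => pev (fk ctr rad i) p) m hm (Lam m) j (hF j)
  rw [pev_QTm r ctr rad τ m hm, h, Bpoly, pev_pderiv_prod _ _ _ _ fun j _ => hg j,
    pev_pderiv_prod _ _ _ _ fun j _ => hg j]
  simp only [pev_pderiv_zero_gpoly, pev_pderiv_one_gpoly]
  ring

open scoped Topology

/-- A Lyapunov-type trapping criterion: `g` increases at a rate in `[a, b]` while `v ∈ (0, δ)`,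
is bounded above where `v` is bounded away from `0`, and is large exactly where `v` is small.
Then `v` stays in `(0, δ)` and tends to `0`. -/
theorem tendsto_zero_of_trapped {v g : ℝ → ℝ} {a b δ δ' M : ℝ} (ha : 0 < a)
    (hv : Continuous v) (hδ' : δ' ≤ δ / 2)
    (hg : ∀ t, 0 ≤ t → 0 < v t → v t < δ → ∃ g', HasDerivAt g g' t ∧ a ≤ g' ∧ g' ≤ b)
    (hlarge : ∀ K : ℝ, ∃ η > 0, ∀ t, 0 < v t → v t < η → K < g t)
    (hbdd : ∀ η > 0, ∃ K : ℝ, ∀ t, η ≤ v t → v t < δ → g t ≤ K)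
    (hM : ∀ t, δ / 2 ≤ v t → v t < δ → g t ≤ M)
    (hM' : ∀ t, 0 < v t → v t < δ' → M < g t)
    (h0 : 0 < v 0) (h0' : v 0 < δ') :
    Tendsto v atTop (𝓝 0) := by
  have hδ : 0 < δ / 2 := by linarith
  -- on an interval where `v` stays in the strip, `g` has controlled increments
  have key : ∀ T, 0 ≤ T → (∀ t ∈ Ico 0 T, 0 < v t ∧ v t < δ / 2) →
      ∀ t ∈ Ico 0 T, g 0 + a * t ≤ g t ∧ g t ≤ g 0 + b * t := by
    intro T hT hs t ht
    have hd : ∀ s ∈ Icc 0 t, ∃ g', HasDerivAt g g' s ∧ a ≤ g' ∧ g' ≤ b := fun s hs' => by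
      have := hs s ⟨hs'.1, hs'.2.trans_lt ht.2⟩
      exact hg s hs'.1 this.1 (by linarith)
    have hcont : ContinuousOn g (Icc 0 t) := fun s hs' => by
      obtain ⟨g', h, -⟩ := hd s hs'
      exact h.continuousAt.continuousWithinAt
    have hdiff : DifferentiableOn ℝ g (interior (Icc 0 t)) := fun s hs' => by
      obtain ⟨g', h, -⟩ := hd s (interior_subset hs')
      exact h.differentiableAt.differentiableWithinAt
    have h1 := (convex_Icc 0 t).mul_sub_le_image_sub_of_le_deriv hcont hdiff (C := a)
      (fun s hs' => by
        obtain ⟨g', h, h', -⟩ := hd s (interior_subset hs')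
        rwa [h.deriv]) 0 (left_mem_Icc.2 ht.1) t (right_mem_Icc.2 ht.1) ht.1
    have h2 := (convex_Icc 0 t).image_sub_le_mul_sub_of_deriv_le hcont hdiff (C := b)
      (fun s hs' => by
        obtain ⟨g', h, -, h'⟩ := hd s (interior_subset hs')
        rwa [h.deriv]) 0 (left_mem_Icc.2 ht.1) t (right_mem_Icc.2 ht.1) ht.1
    constructor <;> linarith
  have hg0 : M < g 0 := hM' 0 h0 h0'
  have stay : ∀ t, 0 ≤ t → 0 < v t ∧ v t < δ / 2 := by
    by_contra! hcon
    obtain ⟨t, ht0, ht⟩ := hcon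
    have hclosed : IsClosed ({t | v t ≤ 0} ∪ {t | δ / 2 ≤ v t}) :=
      (isClosed_le hv continuous_const).union (isClosed_le continuous_const hv)
    set E := Ici 0 ∩ ({t | v t ≤ 0} ∪ {t | δ / 2 ≤ v t})
    have hEc : IsClosed E := isClosed_Ici.inter hclosed
    have hEne : E.Nonempty := ⟨t, ht0, by
      rcases le_or_gt (v t) 0 with h | h
      · exact Or.inl h
      · exact Or.inr (ht h)⟩
    have hEb : BddBelow E := ⟨0, fun s hs => hs.1⟩
    set T := sInf E
    have hT : T ∈ E := hEc.csInf_mem hEne hEb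
    have hT0 : 0 ≤ T := hT.1
    have hbefore : ∀ t ∈ Ico 0 T, 0 < v t ∧ v t < δ / 2 := fun s hs => by
      by_contra hcon
      have : s ∈ E := ⟨hs.1, by
        by_contra h
        simp only [mem_union, mem_ofPred_eq, not_or, not_le] at h
        exact hcon h⟩
      exact absurd (csInf_le hEb this) (not_le.2 hs.2)
    have hTpos : 0 < T := by
      rcases hT0.eq_or_lt with h | h
      · rw [← h] at hT
        rcases hT.2 with h' | h'
        · exact absurd h0 (not_lt.2 h')
        · have : δ / 2 ≤ v 0 := h'
          linarith
      · exact h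
    have hk := key T hT0 hbefore
    have hleft : ∀ᶠ s in 𝓝[<] T, s ∈ Ico 0 T := by
      filter_upwards [Ioo_mem_nhdsLT hTpos] with s hs using ⟨hs.1.le, hs.2⟩
    have hvT : Tendsto v (𝓝[<] T) (𝓝 (v T)) := hv.continuousAt.mono_left nhdsWithin_le_nhds
    have hvlo : 0 ≤ v T := ge_of_tendsto hvT (hleft.mono fun s hs => (hbefore s hs).1.le)
    have hvhi : v T ≤ δ / 2 := le_of_tendsto hvT (hleft.mono fun s hs => (hbefore s hs).2.le)
    rcases hvlo.eq_or_lt with hz | hpos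
    · obtain ⟨η, hη, hη'⟩ := hlarge (g 0 + |b| * T)
      have h1 : ∀ᶠ s in 𝓝[<] T, v s < η := hvT.eventually_lt_const (by rw [← hz]; exact hη)
      obtain ⟨s, hs, hs'⟩ := (h1.and hleft).exists
      have h2 := hη' s (hbefore s hs').1 hs
      have h3 := (hk s hs').2
      have h4 : b * s ≤ |b| * T :=
        (mul_le_mul_of_nonneg_right (le_abs_self b) hs'.1).trans
          (mul_le_mul_of_nonneg_left hs'.2.le (abs_nonneg b))
      linarith
    · have hTe : v T = δ / 2 := by
        rcases hT.2 with h' | h'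
        · exact absurd hpos (not_lt.2 h')
        · exact le_antisymm hvhi h'
      obtain ⟨g', hgd, -⟩ := hg T hT0 hpos (by linarith)
      have h1 : g 0 ≤ g T := by
        refine ge_of_tendsto (hgd.continuousAt.mono_left nhdsWithin_le_nhds)
          (hleft.mono fun s hs => ?_)
        have := (hk s hs).1
        nlinarith [mul_nonneg ha.le hs.1]
      have h2 := hM T hTe.ge (by linarith)
      linarith
  have hgrow : ∀ t, 0 ≤ t → g 0 + a * t ≤ g t := fun t ht =>
    (key (t + 1) (by linarith) (fun s hs => stay s hs.1) t ⟨ht, by linarith⟩).1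
  rw [Metric.tendsto_atTop]
  intro η hη
  obtain ⟨K, hK⟩ := hbdd η hη
  refine ⟨max 0 ((K - g 0) / a + 1), fun t ht => ?_⟩
  have ht0 : 0 ≤ t := (le_max_left _ _).trans ht
  have ht1 : (K - g 0) / a < t := by
    have := (le_max_right _ _).trans ht
    linarith
  rw [div_lt_iff₀ ha] at ht1
  have h1 := hgrow t ht0
  obtain ⟨h2, h3⟩ := stay t ht0
  rw [Real.dist_eq, sub_zero, abs_of_pos h2]
  by_contra! h4
  have := hK t h4 (by linarith)
  nlinarith

/-- A primitive of `u ↦ 1 / u ^ m` on `ℝ \ {0}`. -/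
def powPrim (m : ℕ) (u : ℝ) : ℝ :=
  if m = 1 then Real.log u else -(1 / (((m - 1 : ℕ) : ℝ) * u ^ (m - 1)))

theorem hasDerivAt_powPrim {m : ℕ} (hm : 1 ≤ m) {u : ℝ} (hu : u ≠ 0) :
    HasDerivAt (powPrim m) (1 / u ^ m) u := by
  obtain ⟨k, rfl⟩ : ∃ k, m = k + 1 := ⟨m - 1, by omega⟩
  rcases k with _ | k
  · have : powPrim (0 + 1) = Real.log := by ext; simp [powPrim]
    rw [this]
    simpa using Real.hasDerivAt_log hu
  · have : powPrim (k + 1 + 1) = fun u => -(1 / (((k + 1 : ℕ) : ℝ) * u ^ (k + 1))) := by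
      ext; simp [powPrim]
    rw [this]
    have hk : ((k + 1 : ℕ) : ℝ) ≠ 0 := by positivity
    have h := (((hasDerivAt_pow (k + 1) u).const_mul ((k + 1 : ℕ) : ℝ)).fun_inv
      (mul_ne_zero hk (pow_ne_zero _ hu))).fun_neg
    simp only [one_div]
    refine h.congr_deriv ?_
    simp only [add_tsub_cancel_right]
    field_simp
    ring

/-- A primitive of `u ↦ τ * (1 / u + L / u ^ m)` on `ℝ \ {0}`. -/
def phi (τ L : ℝ) (m : ℕ) (u : ℝ) : ℝ := τ * (Real.log u + L * powPrim m u)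

theorem hasDerivAt_phi (τ L : ℝ) {m : ℕ} (hm : 1 ≤ m) {u : ℝ} (hu : u ≠ 0) :
    HasDerivAt (phi τ L m) (τ * (1 / u + L * (1 / u ^ m))) u := by
  have := ((Real.hasDerivAt_log hu).fun_add ((hasDerivAt_powPrim hm hu).const_mul L)).const_mul τ
  unfold phi
  simpa only [one_div] using this

theorem tendsto_neg_log_nhdsGT_zero {c : ℝ} (hc : 0 < c) :
    Tendsto (fun v : ℝ => -(c * Real.log v)) (𝓝[>] 0) atTop :=
  tendsto_neg_atBot_atTop.comp (Real.tendsto_log_nhdsGT_zero.const_mul_atBot hc)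

theorem tendsto_phi_pos {τ L : ℝ} (hτ : 0 < τ) (hL : 0 ≤ L) (m : ℕ) :
    Tendsto (fun v => -phi τ L m v) (𝓝[>] 0) atTop := by
  refine tendsto_atTop_mono' _ ?_ (tendsto_neg_log_nhdsGT_zero hτ)
  filter_upwards [Ioo_mem_nhdsGT (one_pos : (0 : ℝ) < 1)] with v hv
  have : powPrim m v ≤ 0 := by
    unfold powPrim
    split_ifs
    · exact Real.log_nonpos hv.1.le hv.2.le
    · have := hv.1
      rw [neg_nonpos]
      positivity
  unfold phi
  nlinarith [mul_nonneg hτ.le (mul_nonneg hL (neg_nonneg.2 this))]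

theorem tendsto_phi_neg {τ L : ℝ} (hτ : 0 < τ) {m : ℕ} (hm : 1 ≤ m) (hL : 0 ≤ L)
    (hL' : m ≠ 1 → 0 < L) :
    Tendsto (fun v => (-1) ^ m * phi τ L m (-v)) (𝓝[>] 0) atTop := by
  rcases Nat.even_or_odd m with he | ho
  · have hm1 : m ≠ 1 := by rintro rfl; simp at he
    have hL'' := hL' hm1
    have hm2 : 2 ≤ m := by omega
    set d : ℝ := ((m - 1 : ℕ) : ℝ)
    have hd : 0 < d := by simp only [d]; exact_mod_cast (by omega : 0 < m - 1)
    set c := L / d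
    have hc : 0 < c := div_pos hL'' hd
    have hw : Tendsto (fun v : ℝ => τ * (c / 2 * v⁻¹ + (1 + Real.log (c / 2)))) (𝓝[>] 0) atTop :=
      (tendsto_atTop_add_const_right _ _
        (tendsto_inv_nhdsGT_zero.const_mul_atTop (by positivity))).const_mul_atTop hτ
    refine tendsto_atTop_mono' _ ?_ hw
    filter_upwards [Ioo_mem_nhdsGT (one_pos : (0 : ℝ) < 1)] with v hv
    have hv0 := hv.1
    have hodd : Odd (m - 1) := by
      rcases he with ⟨k, hk⟩
      exact ⟨k - 1, by omega⟩
    rw [he.neg_one_pow, one_mul, phi, powPrim, if_neg hm1, hodd.neg_pow, Real.log_neg_eq_log]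
    refine mul_le_mul_of_nonneg_left ?_ hτ.le
    have h1 : v ^ (m - 1) ≤ v := pow_le_of_le_one hv0.le hv.2.le (by omega)
    have h2 : v⁻¹ ≤ (v ^ (m - 1))⁻¹ := inv_anti₀ (by positivity) h1
    have h3 : L * -(1 / (d * -v ^ (m - 1))) = c * (v ^ (m - 1))⁻¹ := by
      simp only [c]
      field_simp
    have h4 := Real.log_le_sub_one_of_pos (x := c / 2 * v⁻¹) (by positivity)
    rw [Real.log_mul (by positivity) (by positivity), Real.log_inv] at h4
    change _ ≤ Real.log v + L * -(1 / (d * -v ^ (m - 1)))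
    rw [h3]
    nlinarith [mul_le_mul_of_nonneg_left h2 hc.le]
  · refine (tendsto_phi_pos hτ hL m).congr fun v => ?_
    have : powPrim m (-v) = powPrim m v := by
      unfold powPrim
      split_ifs with h
      · exact Real.log_neg_eq_log v
      · have : Even (m - 1) := by
          rcases ho with ⟨k, hk⟩
          exact ⟨k, by omega⟩
        rw [this.neg_pow]
    rw [ho.neg_one_pow, phi, phi, this, Real.log_neg_eq_log]
    ring

theorem IsCompact.eventually_nhdsSet_abs_le {S : Set (ℝ × ℝ)} (hS : IsCompact S)
    {h : ℝ × ℝ → ℝ} (hc : ∀ p ∈ S, ContinuousAt h p) :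
    ∃ M, ∀ᶠ p in 𝓝ˢ S, |h p| ≤ M := by
  obtain ⟨M, hM⟩ := hS.exists_bound_of_continuousOn fun p hp => (hc p hp).continuousWithinAt
  refine ⟨M + 1, eventually_nhdsSet_iff_forall.2 fun p hp => ?_⟩
  have h1 : |h p| < M + 1 := (hM p hp).trans_lt (lt_add_one M)
  exact ((hc p hp).abs.eventually_lt_const h1).mono fun q hq => hq.le

theorem IsCompact.eventually_nhdsSet_pos_le {S : Set (ℝ × ℝ)} (hS : IsCompact S)
    {h : ℝ × ℝ → ℝ} (hc : ∀ p ∈ S, ContinuousAt h p) (hpos : ∀ p ∈ S, 0 < h p) :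
    ∃ a > 0, ∀ᶠ p in 𝓝ˢ S, a ≤ h p := by
  rcases S.eq_empty_or_nonempty with rfl | hne
  · exact ⟨1, one_pos, by simp⟩
  obtain ⟨q, hq, hmin⟩ := hS.exists_isMinOn hne fun p hp => (hc p hp).continuousWithinAt
  refine ⟨h q / 2, half_pos (hpos q hq), eventually_nhdsSet_iff_forall.2 fun p hp => ?_⟩
  have h1 : h q / 2 < h p := (half_lt_self (hpos q hq)).trans_le (hmin hp)
  exact ((hc p hp).eventually_const_lt h1).mono fun q hq => hq.le

/-- Periodic positive scalar equations `θ' = h(θ)` have global solutions running through `ℝ`. -/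
theorem exists_lift_solution {h : ℝ → ℝ} (hc : Continuous h) (hpos : ∀ x, 0 < h x)
    {P : ℝ} (hP : 0 < P) (hper : Function.Periodic h P) :
    ∃ θ : ℝ → ℝ, ∃ T > 0, (∀ t, HasDerivAt θ (h (θ t)) t) ∧ (∀ t, θ (t + T) = θ t + P) ∧
      Surjective θ := by
  have hci : Continuous fun x => (h x)⁻¹ := hc.inv₀ fun x => (hpos x).ne'
  set F : ℝ → ℝ := fun x => ∫ y in (0 : ℝ)..x, (h y)⁻¹
  have hF : ∀ x, HasDerivAt F (h x)⁻¹ x := fun x =>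
    intervalIntegral.integral_hasDerivAt_right (hci.intervalIntegrable _ _)
      (hci.stronglyMeasurableAtFilter _ _) hci.continuousAt
  have hmono : StrictMono F := strictMono_of_deriv_pos fun x => by
    rw [(hF x).deriv]
    exact inv_pos.2 (hpos x)
  have hF0 : F 0 = 0 := by simp [F]
  have hFP : ∀ x, F (x + P) = F x + F P := fun x => by
    have h1 : (∫ y in x..x + P, (h y)⁻¹) = ∫ y in (0 : ℝ)..0 + P, (h y)⁻¹ :=
      Function.Periodic.intervalIntegral_add_eq (f := fun y => (h y)⁻¹)
        (fun y => by simp only [hper y]) x 0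
    have h2 := intervalIntegral.integral_add_adjacent_intervals
      (hci.intervalIntegrable (μ := MeasureTheory.volume) 0 x)
      (hci.intervalIntegrable (μ := MeasureTheory.volume) x (x + P))
    rw [h1, zero_add] at h2
    exact h2.symm
  have hT : 0 < F P := by rw [← hF0]; exact hmono hP
  have hFn : ∀ N : ℕ, F (N * P) = N * F P ∧ F (-(N * P)) = -(N * F P) := fun N => by
    induction N with
    | zero => simp [hF0]
    | succ N ih =>
      constructor
      · have := hFP (N * P)
        push_cast
        rw [show ((N : ℝ) + 1) * P = N * P + P by ring, this, ih.1]
        ring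
      · have := hFP (-(((N + 1 : ℕ) : ℝ) * P))
        rw [show -(((N + 1 : ℕ) : ℝ) * P) + P = -(N * P) by push_cast; ring, ih.2] at this
        push_cast at this ⊢
        linarith
  have hFc : Continuous F := continuous_iff_continuousAt.2 fun x => (hF x).continuousAt
  have hsurj : Surjective F := fun y => by
    obtain ⟨N, hN⟩ := exists_nat_gt (|y| / F P)
    rw [div_lt_iff₀ hT] at hN
    have h1 := abs_lt.1 hN
    refine mem_range_of_exists_le_of_exists_ge hFc ⟨-(N * P), ?_⟩ ⟨N * P, ?_⟩
    · rw [(hFn N).2]; linarith [h1.1]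
    · rw [(hFn N).1]; linarith [h1.2]
  set e := hmono.orderIsoOfSurjective F hsurj
  have he : ∀ x, F (e.symm x) = x := fun x => e.apply_symm_apply x
  refine ⟨e.symm, F P, hT, fun t => ?_, fun t => ?_, e.symm.surjective⟩
  · have := HasDerivAt.of_local_left_inverse (f := F) (g := e.symm) (a := t)
      e.symm.continuous.continuousAt (hF _) (inv_ne_zero (hpos _).ne')
      (Eventually.of_forall he)
    simpa using this
  · apply hmono.injective
    rw [he, hFP, he]

section Circles

variable (ctr : Fin n → ℝ × ℝ) (rad : Fin n → ℝ)

theorem mem_Ccir {k : Fin n} {p : ℝ × ℝ} :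
    p ∈ Ccir ctr rad k ↔ (p.1 - (ctr k).1) ^ 2 + (p.2 - (ctr k).2) ^ 2 = rad k ^ 2 := by
  change pev (fk ctr rad k) p = 0 ↔ _
  rw [pev_fk, sub_eq_zero]

theorem mem_Ddisc {k : Fin n} {p : ℝ × ℝ} :
    p ∈ Ddisc ctr rad k ↔ (p.1 - (ctr k).1) ^ 2 + (p.2 - (ctr k).2) ^ 2 ≤ rad k ^ 2 := Iff.rfl

/-- The standard parametrization of the circle `C_k`. -/
def circlePt (k : Fin n) (θ : ℝ) : ℝ × ℝ :=
  ((ctr k).1 + rad k * Real.cos θ, (ctr k).2 + rad k * Real.sin θ)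

theorem circlePt_mem (k : Fin n) (θ : ℝ) : circlePt ctr rad k θ ∈ Ccir ctr rad k := by
  rw [mem_Ccir]
  simp only [circlePt, add_sub_cancel_left]
  linear_combination rad k ^ 2 * Real.sin_sq_add_cos_sq θ

theorem continuous_circlePt (k : Fin n) : Continuous (circlePt ctr rad k) := by
  unfold circlePt
  fun_prop

variable {rad}

theorem exists_circlePt_eq {k : Fin n} (hr : 0 < rad k) {p : ℝ × ℝ} (hp : p ∈ Ccir ctr rad k) :
    ∃ θ, circlePt ctr rad k θ = p := by
  rw [mem_Ccir] at hp
  set z : ℂ := ⟨(p.1 - (ctr k).1), (p.2 - (ctr k).2)⟩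
  have hz : ‖z‖ = rad k := by
    rw [Complex.norm_def, Complex.normSq_mk, ← Real.sqrt_sq hr.le, ← hp]
    congr 1
    ring
  refine ⟨z.arg, Prod.ext ?_ ?_⟩
  · have := Complex.norm_mul_cos_arg z
    rw [hz] at this
    simp [circlePt, this, z]
  · have := Complex.norm_mul_sin_arg z
    rw [hz] at this
    simp [circlePt, this, z]

theorem range_circlePt {k : Fin n} (hr : 0 < rad k) :
    range (circlePt ctr rad k) = Ccir ctr rad k :=
  Subset.antisymm (range_subset_iff.2 (circlePt_mem ctr rad k))
    fun _ hp => exists_circlePt_eq ctr hr hp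

theorem isPreconnected_Ccir {k : Fin n} (hr : 0 < rad k) : IsPreconnected (Ccir ctr rad k) := by
  rw [← range_circlePt ctr hr]
  exact isPreconnected_range (continuous_circlePt ctr rad k)

theorem isCompact_Ccir {k : Fin n} (hr : 0 < rad k) : IsCompact (Ccir ctr rad k) := by
  have h : circlePt ctr rad k '' Icc 0 (0 + 2 * π) = range (circlePt ctr rad k) :=
    Function.Periodic.image_Icc (fun θ => by simp [circlePt]) (by positivity) 0
  rw [← range_circlePt ctr hr, ← h]
  exact isCompact_Icc.image (continuous_circlePt ctr rad k)

theorem infDist_Ccir_le {k : Fin n} (hr : 0 < rad k) (p : ℝ × ℝ) :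
    Metric.infDist p (Ccir ctr rad k) ≤ |pev (fk ctr rad k) p| / rad k := by
  rw [pev_fk]
  set z : ℂ := ⟨(p.1 - (ctr k).1), (p.2 - (ctr k).2)⟩
  have hz : (p.1 - (ctr k).1) ^ 2 + (p.2 - (ctr k).2) ^ 2 = ‖z‖ ^ 2 := by
    rw [← Complex.normSq_eq_norm_sq, Complex.normSq_mk]
    ring
  rw [hz]
  have h1 : |‖z‖ - rad k| ≤ |‖z‖ ^ 2 - rad k ^ 2| / rad k := by
    rw [le_div_iff₀ hr, sq_sub_sq, abs_mul, mul_comm]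
    refine mul_le_mul_of_nonneg_right ?_ (abs_nonneg _)
    rw [abs_of_pos (by positivity)]
    linarith [norm_nonneg z]
  refine le_trans ?_ h1
  refine (Metric.infDist_le_dist_of_mem (circlePt_mem ctr rad k z.arg)).trans ?_
  have hx : p.1 = (ctr k).1 + ‖z‖ * Real.cos z.arg := by
    rw [Complex.norm_mul_cos_arg z]
    simp [z]
  have hy : p.2 = (ctr k).2 + ‖z‖ * Real.sin z.arg := by
    rw [Complex.norm_mul_sin_arg z]
    simp [z]
  rw [Prod.dist_eq, Real.dist_eq, Real.dist_eq, hx, hy]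
  simp only [circlePt, add_sub_add_left_eq_sub, ← sub_mul, abs_mul]
  exact max_le (mul_le_of_le_one_right (abs_nonneg _) (Real.abs_cos_le_one _))
    (mul_le_of_le_one_right (abs_nonneg _) (Real.abs_sin_le_one _))

theorem exists_strip_of_eventually {k : Fin n} (hr : 0 < rad k) {W : ℝ × ℝ → Prop}
    (hW : ∀ᶠ p in 𝓝ˢ (Ccir ctr rad k), W p) :
    ∃ δ > 0, ∀ p, |pev (fk ctr rad k) p| < δ → W p := by
  obtain ⟨V, hV, hSV, hVW⟩ := eventually_nhdsSet_iff_exists.1 hW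
  obtain ⟨ε, hε, hεV⟩ := (isCompact_Ccir ctr hr).exists_thickening_subset_open hV hSV
  have hne : (Ccir ctr rad k).Nonempty := ⟨_, circlePt_mem ctr rad k 0⟩
  refine ⟨ε * rad k, by positivity, fun p hp => hVW p (hεV ?_)⟩
  rw [Metric.mem_thickening_iff_infDist_lt hne]
  refine (infDist_Ccir_le ctr hr p).trans_lt ?_
  rwa [div_lt_iff₀ hr]

theorem pev_fk_neg_iff {k : Fin n} {p : ℝ × ℝ} :
    p ∈ Ddisc ctr rad k \ Ccir ctr rad k ↔ pev (fk ctr rad k) p < 0 := by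
  rw [Set.mem_sdiff, mem_Ddisc, mem_Ccir, pev_fk, sub_lt_zero, lt_iff_le_and_ne]

/-- On a circle disjoint from `C_j`, `f_j` is negative if the circle lies in the disc of `C_j` and
positive otherwise. -/
theorem fk_sign_on_Ccir (hrad : ∀ k, 0 < rad k)
    (hdisj : ∀ j k, j ≠ k → Disjoint (Ccir ctr rad j) (Ccir ctr rad k)) {j k : Fin n}
    (hjk : j ≠ k) {p : ℝ × ℝ} (hp : p ∈ Ccir ctr rad k) :
    (Ccir ctr rad k ⊆ Ddisc ctr rad j → pev (fk ctr rad j) p < 0) ∧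
      (¬ Ccir ctr rad k ⊆ Ddisc ctr rad j → 0 < pev (fk ctr rad j) p) := by
  have hne : ∀ q ∈ Ccir ctr rad k, q ∉ Ccir ctr rad j := fun q hq hq' =>
    (Set.disjoint_left.1 (hdisj j k hjk)) hq' hq
  refine ⟨fun h => (pev_fk_neg_iff ctr).1 ⟨h hp, hne p hp⟩, fun h => ?_⟩
  obtain ⟨q, hq, hq'⟩ := Set.not_subset.1 h
  have hq0 : 0 < pev (fk ctr rad j) q := by
    rw [pev_fk, sub_pos]
    exact not_le.1 hq'
  by_contra! hcon
  obtain ⟨x, hx, hx0⟩ := (isPreconnected_Ccir ctr (hrad k)).intermediate_value hp hq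
    (continuous_pev (fk ctr rad j)).continuousOn ⟨hcon, hq0.le⟩
  exact hne x hx hx0

theorem Ddisc_subset_of_Ccir_subset {i j : Fin n}
    (h : Ccir ctr rad i ⊆ Ddisc ctr rad j) : Ddisc ctr rad i ⊆ Ddisc ctr rad j := by
  intro p hp
  rw [mem_Ddisc] at hp ⊢
  set s := Real.sqrt (rad i ^ 2 - (p.2 - (ctr i).2) ^ 2)
  have hs : s ^ 2 = rad i ^ 2 - (p.2 - (ctr i).2) ^ 2 :=
    Real.sq_sqrt (by nlinarith [sq_nonneg (p.1 - (ctr i).1)])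
  have hs0 : 0 ≤ s := Real.sqrt_nonneg _
  have h1 : ((ctr i).1 + s, p.2) ∈ Ccir ctr rad i := by
    rw [mem_Ccir]
    simp only [add_sub_cancel_left, hs]
    ring
  have h2 : ((ctr i).1 - s, p.2) ∈ Ccir ctr rad i := by
    rw [mem_Ccir]
    simp only
    linear_combination hs
  have h3 := h h1
  have h4 := h h2
  rw [mem_Ddisc] at h3 h4
  simp only at h3 h4
  have h5 : |p.1 - (ctr i).1| ≤ s := abs_le_of_sq_le_sq (by linarith) hs0
  rw [abs_le] at h5
  rcases le_total (p.1 - (ctr j).1) 0 with h6 | h6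
  · nlinarith [mul_nonneg (sub_nonneg.2 h5.1) (neg_nonneg.2 h6)]
  · nlinarith [mul_nonneg (sub_nonneg.2 h5.2) h6]

theorem rad_lt_of_Ccir_subset (hrad : ∀ k, 0 < rad k)
    (hdisj : ∀ j k, j ≠ k → Disjoint (Ccir ctr rad j) (Ccir ctr rad k)) {i j : Fin n}
    (hij : i ≠ j) (h : Ccir ctr rad i ⊆ Ddisc ctr rad j) : rad i < rad j := by
  have h1 := circlePt_mem ctr rad i 0
  have h2 := circlePt_mem ctr rad i π
  have h1' := (pev_fk_neg_iff ctr).1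
    ⟨h h1, fun hq => (Set.disjoint_left.1 (hdisj i j hij)) h1 hq⟩
  have h2' := (pev_fk_neg_iff ctr).1
    ⟨h h2, fun hq => (Set.disjoint_left.1 (hdisj i j hij)) h2 hq⟩
  rw [pev_fk] at h1' h2'
  simp only [circlePt, Real.cos_zero, Real.sin_zero, Real.cos_pi, Real.sin_pi] at h1' h2'
  refine lt_of_pow_lt_pow_left₀ 2 (hrad j).le ?_
  nlinarith [sq_nonneg ((ctr i).1 - (ctr j).1), sq_nonneg ((ctr i).2 - (ctr j).2)]

theorem exists_primary_subset (hrad : ∀ k, 0 < rad k)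
    (hdisj : ∀ j k, j ≠ k → Disjoint (Ccir ctr rad j) (Ccir ctr rad k)) (k : Fin n) :
    ∃ j, Primary ctr rad j ∧ Ccir ctr rad j ⊆ Ddisc ctr rad k := by
  have hne : (Finset.univ.filter fun j => Ccir ctr rad j ⊆ Ddisc ctr rad k).Nonempty :=
    ⟨k, by
      simp only [Finset.mem_filter, Finset.mem_univ, true_and]
      exact fun p hp => ((mem_Ccir ctr rad).1 hp).le⟩
  obtain ⟨j, hj, hmin⟩ := Finset.exists_min_image _ rad hne
  simp only [Finset.mem_filter, Finset.mem_univ, true_and] at hj hmin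
  refine ⟨j, fun i hi hsub => ?_, hj⟩
  have h1 := rad_lt_of_Ccir_subset ctr hrad hdisj hi hsub
  have h2 := hmin i (hsub.trans (Ddisc_subset_of_Ccir_subset ctr hj))
  linarith

theorem ctr_mem_Ddisc_of_Ccir_subset {j k : Fin n}
    (h : Ccir ctr rad j ⊆ Ddisc ctr rad k) : ctr j ∈ Ddisc ctr rad k := by
  refine Ddisc_subset_of_Ccir_subset ctr h ?_
  rw [mem_Ddisc]
  simpa using sq_nonneg (rad j)

/-- The sign of `λ_k` on `C_k` is `(-1) ^ M_k`. -/
theorem neg_one_pow_Mk_mul_prod_pos (hrad : ∀ k, 0 < rad k)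
    (hdisj : ∀ j k, j ≠ k → Disjoint (Ccir ctr rad j) (Ccir ctr rad k)) (m : Fin n → ℕ)
    {k : Fin n} {p : ℝ × ℝ} (hp : p ∈ Ccir ctr rad k) :
    0 < (-1 : ℝ) ^ Mk ctr rad m k *
      ∏ i ∈ Finset.univ.erase k, pev (fk ctr rad i) p ^ m i := by
  have h : (-1 : ℝ) ^ Mk ctr rad m k = ∏ i ∈ Finset.univ.erase k,
      (if Ccir ctr rad k ⊆ Ddisc ctr rad i then (-1 : ℝ) else 1) ^ m i := by
    rw [Mk, ← Finset.prod_pow_eq_pow_sum]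
    have : Finset.univ.filter (fun j : Fin n => j ≠ k ∧ Ccir ctr rad k ⊆ Ddisc ctr rad j) =
        (Finset.univ.erase k).filter (fun j => Ccir ctr rad k ⊆ Ddisc ctr rad j) := by
      ext j
      simp
    rw [this, Finset.prod_filter]
    refine Finset.prod_congr rfl fun i _ => ?_
    split_ifs <;> simp
  rw [h, ← Finset.prod_mul_distrib]
  refine Finset.prod_pos fun i hi => ?_
  rw [← mul_pow]
  refine pow_pos ?_ _
  have hs := fk_sign_on_Ccir ctr hrad hdisj (Finset.ne_of_mem_erase hi) hp
  split_ifs with hsub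
  · have := hs.1 hsub
    linarith
  · have := hs.2 hsub
    linarith

end Circles

section Lyapunov

theorem hasDerivAt_arctan_div {a b e h : ℝ → ℝ} {a' b' e' h' t : ℝ} (ha : HasDerivAt a a' t)
    (hb : HasDerivAt b b' t) (he : HasDerivAt e e' t) (hh : HasDerivAt h h' t)
    (hpos : 0 < a t * e t + b t * h t) :
    HasDerivAt (fun t => arctan ((b t * e t - a t * h t) / (a t * e t + b t * h t)))
      ((a t * b' - b t * a') / (a t ^ 2 + b t ^ 2)
        - (e t * h' - h t * e') / (e t ^ 2 + h t ^ 2)) t := by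
  have h1 : (a t ^ 2 + b t ^ 2) * (e t ^ 2 + h t ^ 2) =
      (a t * e t + b t * h t) ^ 2 + (b t * e t - a t * h t) ^ 2 := by ring
  have h2 : a t ^ 2 + b t ^ 2 ≠ 0 := fun h0 => by
    rw [h0, zero_mul] at h1
    nlinarith [sq_nonneg (b t * e t - a t * h t), pow_pos hpos 2]
  have h3 : e t ^ 2 + h t ^ 2 ≠ 0 := fun h0 => by
    rw [h0, mul_zero] at h1
    nlinarith [sq_nonneg (b t * e t - a t * h t), pow_pos hpos 2]
  have key := (((hb.fun_mul he).fun_sub (ha.fun_mul hh)).fun_div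
    ((ha.fun_mul he).fun_add (hb.fun_mul hh)) hpos.ne').arctan
  convert key using 1
  have h4 : 1 + ((b t * e t - a t * h t) / (a t * e t + b t * h t)) ^ 2 =
      (a t ^ 2 + b t ^ 2) * (e t ^ 2 + h t ^ 2) / (a t * e t + b t * h t) ^ 2 := by
    have := hpos.ne'
    rw [h1, add_div, div_self (pow_ne_zero 2 this), div_pow]
  rw [h4]
  have := hpos.ne'
  field_simp
  ring

variable (ctr : Fin n → ℝ × ℝ) (rad : Fin n → ℝ)

/-- A direction which makes an acute angle with `p - c_j` for all `p` close to `C_k`, after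
removing the rotation of `p` around `c_k` when `c_j` lies inside `C_k`. -/
def refDir (k j : Fin n) (p : ℝ × ℝ) : ℝ × ℝ :=
  if ctr j ∈ Ddisc ctr rad k then p - ctr k else ctr k - ctr j

/-- The scalar product of `p - c_j` with the reference direction. -/
def refInner (k j : Fin n) (p : ℝ × ℝ) : ℝ :=
  (p.1 - (ctr j).1) * (refDir ctr rad k j p).1 + (p.2 - (ctr j).2) * (refDir ctr rad k j p).2

/-- The angle between `p - c_j` and the reference direction. -/
def refAngle (k j : Fin n) (p : ℝ × ℝ) : ℝ :=
  arctan (((p.2 - (ctr j).2) * (refDir ctr rad k j p).1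
    - (p.1 - (ctr j).1) * (refDir ctr rad k j p).2) / refInner ctr rad k j p)

theorem continuous_refDir (k j : Fin n) : Continuous (refDir ctr rad k j) := by
  unfold refDir
  split_ifs <;> fun_prop

theorem continuous_refInner (k j : Fin n) : Continuous (refInner ctr rad k j) := by
  have := continuous_refDir ctr rad k j
  unfold refInner
  fun_prop

variable {rad}

theorem sum_mul_lt_of_sq_lt {a b c d ρ : ℝ} (h1 : a ^ 2 + b ^ 2 < ρ ^ 2)
    (h2 : c ^ 2 + d ^ 2 = ρ ^ 2) : a * c + b * d < ρ ^ 2 := by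
  nlinarith [sq_nonneg (a - c), sq_nonneg (b - d)]

theorem refInner_pos (hctr : ∀ j k, ctr j ∉ Ccir ctr rad k) {k : Fin n}
    (j : Fin n) {p : ℝ × ℝ} (hp : p ∈ Ccir ctr rad k) : 0 < refInner ctr rad k j p := by
  have hj := hctr j k
  rw [mem_Ccir] at hp hj
  unfold refInner refDir
  split_ifs with h
  · rw [mem_Ddisc] at h
    have h' := lt_of_le_of_ne h hj
    have := sum_mul_lt_of_sq_lt h' hp
    simp only [Prod.fst_sub, Prod.snd_sub]
    nlinarith
  · rw [mem_Ddisc, not_le] at h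
    set c := (ctr j).1 - (ctr k).1
    set d := (ctr j).2 - (ctr k).2
    set a := p.1 - (ctr k).1
    set b := p.2 - (ctr k).2
    simp only [Prod.fst_sub, Prod.snd_sub]
    have : (p.1 - (ctr j).1) * ((ctr k).1 - (ctr j).1) +
        (p.2 - (ctr j).2) * ((ctr k).2 - (ctr j).2) = c ^ 2 + d ^ 2 - (a * c + b * d) := by
      simp only [a, b, c, d]
      ring
    rw [this]
    nlinarith [sq_nonneg (a - c), sq_nonneg (b - d)]

variable (rad)

theorem continuousAt_refAngle {k j : Fin n} {p : ℝ × ℝ} (h : 0 < refInner ctr rad k j p) :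
    ContinuousAt (refAngle ctr rad k j) p := by
  have h1 := continuous_refDir ctr rad k j
  have h2 := continuous_refInner ctr rad k j
  unfold refAngle
  refine Real.continuous_arctan.continuousAt.comp (ContinuousAt.div ?_ h2.continuousAt h.ne')
  fun_prop

/-- The angular velocity about `c` of a point `p` moving with velocity `v`. -/
def angVel (c p v : ℝ × ℝ) : ℝ :=
  ((p.1 - c.1) * v.2 - (p.2 - c.2) * v.1) / pev (gpoly c) p

theorem hasDerivAt_refAngle {k j : Fin n} {γ : ℝ → ℝ × ℝ} {v : ℝ × ℝ} {t : ℝ}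
    (hγ : HasDerivAt γ v t) (h : 0 < refInner ctr rad k j (γ t)) :
    HasDerivAt (fun t => refAngle ctr rad k j (γ t))
      (angVel (ctr j) (γ t) v
        - if ctr j ∈ Ddisc ctr rad k then angVel (ctr k) (γ t) v else 0) t := by
  have hx : HasDerivAt (fun t => (γ t).1) v.1 t := (ContinuousLinearMap.fst ℝ ℝ ℝ).hasFDerivAt.comp_hasDerivAt t hγ
  have hy : HasDerivAt (fun t => (γ t).2) v.2 t := (ContinuousLinearMap.snd ℝ ℝ ℝ).hasFDerivAt.comp_hasDerivAt t hγ
  unfold refAngle angVel refInner refDir at *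
  split_ifs at h ⊢
  · simp only [Prod.fst_sub, Prod.snd_sub] at h ⊢
    have := hasDerivAt_arctan_div (hx.sub_const (ctr j).1) (hy.sub_const (ctr j).2)
      (hx.sub_const (ctr k).1) (hy.sub_const (ctr k).2) h
    simpa only [pev_gpoly] using this
  · have := hasDerivAt_arctan_div (hx.sub_const (ctr j).1) (hy.sub_const (ctr j).2)
      (hasDerivAt_const t (ctr k - ctr j).1) (hasDerivAt_const t (ctr k - ctr j).2) h
    simpa only [pev_gpoly, mul_zero, sub_self, zero_div] using this

variable (r : ℕ) (τ : Fin n → ℝ) (m : Fin n → ℕ)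

/-- The part of the Lyapunov function of `X_{Tm}` which is continuous along `C_k`. -/
def lyapunovRem (k : Fin n) (p : ℝ × ℝ) : ℝ :=
  (∑ j ∈ Finset.univ.filter (fun k : Fin n => (k : ℕ) < r), Real.log (pev (gpoly (ctr j)) p))
    + (∑ j ∈ Finset.univ.erase k, phi (τ j) (Lam m) (m j) (pev (fk ctr rad j) p))
    - 2 * ∑ j ∈ Finset.univ.filter (fun k : Fin n => (k : ℕ) < r), refAngle ctr rad k j p

/-- A function which is singular along `C_k` and strictly monotone along the orbits of `X_{Tm}`
near `C_k`. -/
def lyapunov (k : Fin n) (p : ℝ × ℝ) : ℝ :=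
  phi (τ k) (Lam m) (m k) (pev (fk ctr rad k) p) + lyapunovRem ctr rad r τ m k p

theorem continuousAt_lyapunovRem (hm : ∀ k, 1 ≤ m k) {k : Fin n} {p : ℝ × ℝ}
    (hF : ∀ j ≠ k, pev (fk ctr rad j) p ≠ 0) (hg : ∀ j, pev (gpoly (ctr j)) p ≠ 0)
    (hI : ∀ j, 0 < refInner ctr rad k j p) :
    ContinuousAt (lyapunovRem ctr rad r τ m k) p := by
  unfold lyapunovRem
  refine ((tendsto_finsetSum _ fun j _ => ?_).add (tendsto_finsetSum _ fun j hj => ?_)).sub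
    ((tendsto_finsetSum _ fun j _ => ?_).const_mul 2)
  · exact (continuous_pev _).continuousAt.log (hg j)
  · exact ContinuousAt.comp (g := phi (τ j) (Lam m) (m j))
      (hasDerivAt_phi (τ j) (Lam m) (hm j) (hF j (Finset.ne_of_mem_erase hj))).continuousAt
      (continuous_pev (fk ctr rad j)).continuousAt
  · exact continuousAt_refAngle ctr rad (hI j)

theorem hasDerivAt_lyapunov (hm : ∀ k, 1 ≤ m k) {k : Fin n} {γ : ℝ → ℝ × ℝ}
    (hγ : IsSolution (PTm r ctr rad τ m) (QTm r ctr rad τ m) γ) {t : ℝ}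
    (hF : ∀ j, pev (fk ctr rad j) (γ t) ≠ 0) (hg : ∀ j, pev (gpoly (ctr j)) (γ t) ≠ 0)
    (hI : ∀ j, 0 < refInner ctr rad k j (γ t)) :
    HasDerivAt (fun t => lyapunov ctr rad r τ m k (γ t))
      (2 * (Finset.univ.filter
          (fun j : Fin n => (j : ℕ) < r ∧ ctr j ∈ Ddisc ctr rad k)).card *
        angVel (ctr k) (γ t)
          (pev (PTm r ctr rad τ m) (γ t), pev (QTm r ctr rad τ m) (γ t))) t := by
  have hE : (fun t => lyapunov ctr rad r τ m k (γ t)) = fun t =>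
      (∑ j ∈ Finset.univ.filter (fun k : Fin n => (k : ℕ) < r),
          Real.log (pev (gpoly (ctr j)) (γ t)))
        + (∑ j, phi (τ j) (Lam m) (m j) (pev (fk ctr rad j) (γ t)))
        - 2 * ∑ j ∈ Finset.univ.filter (fun k : Fin n => (k : ℕ) < r),
          refAngle ctr rad k j (γ t) := by
    ext t
    rw [lyapunov, lyapunovRem, ← Finset.add_sum_erase Finset.univ
      (fun j => phi (τ j) (Lam m) (m j) (pev (fk ctr rad j) (γ t))) (Finset.mem_univ k)]
    ring
  rw [hE]
  have hx : HasDerivAt (fun t => (γ t).1) (pev (PTm r ctr rad τ m) (γ t)) t :=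
    (ContinuousLinearMap.fst ℝ ℝ ℝ).hasFDerivAt.comp_hasDerivAt t (hγ t)
  have hy : HasDerivAt (fun t => (γ t).2) (pev (QTm r ctr rad τ m) (γ t)) t :=
    (ContinuousLinearMap.snd ℝ ℝ ℝ).hasFDerivAt.comp_hasDerivAt t (hγ t)
  have hgd : ∀ j, HasDerivAt (fun t => pev (gpoly (ctr j)) (γ t))
      (2 * ((γ t).1 - (ctr j).1) * pev (PTm r ctr rad τ m) (γ t)
        + 2 * ((γ t).2 - (ctr j).2) * pev (QTm r ctr rad τ m) (γ t)) t := fun j => by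
    simp only [pev_gpoly]
    refine HasDerivAt.congr_deriv
      (((hx.sub_const (ctr j).1).fun_pow 2).fun_add ((hy.sub_const (ctr j).2).fun_pow 2)) ?_
    norm_num
  have hfd : ∀ j, HasDerivAt (fun t => pev (fk ctr rad j) (γ t))
      (2 * ((γ t).1 - (ctr j).1) * pev (PTm r ctr rad τ m) (γ t)
        + 2 * ((γ t).2 - (ctr j).2) * pev (QTm r ctr rad τ m) (γ t)) t := fun j => by
    have := (hgd j).sub_const (rad j ^ 2)
    simpa only [pev_gpoly, pev_fk] using this
  have key := ((HasDerivAt.fun_sum (u := Finset.univ.filter (fun k : Fin n => (k : ℕ) < r))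
      fun j _ => (hgd j).log (hg j)).fun_add
    (HasDerivAt.fun_sum (u := Finset.univ) fun j _ =>
      (hasDerivAt_phi (τ j) (Lam m) (hm j) (hF j)).comp t (hfd j))).fun_sub
    ((HasDerivAt.fun_sum (u := Finset.univ.filter (fun k : Fin n => (k : ℕ) < r))
      fun j _ => hasDerivAt_refAngle ctr rad (hγ t) (hI j)).const_mul 2)
  refine HasDerivAt.congr_deriv key ?_
  have h1 := pev_PTm_of_ne_zero r ctr rad τ m hm (γ t) hF hg
  have h2 := pev_QTm_of_ne_zero r ctr rad τ m hm (γ t) hF hg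
  set p := γ t
  set P := pev (PTm r ctr rad τ m) p
  set Q := pev (QTm r ctr rad τ m) p
  set V := pev (Bpoly r ctr) p * ∏ j, pev (fk ctr rad j) p ^ m j
  set Lx := ∑ j ∈ Finset.univ.filter (fun k : Fin n => (k : ℕ) < r),
    2 * (p.1 - (ctr j).1) / pev (gpoly (ctr j)) p with hLx
  set Ly := ∑ j ∈ Finset.univ.filter (fun k : Fin n => (k : ℕ) < r),
    2 * (p.2 - (ctr j).2) / pev (gpoly (ctr j)) p with hLy
  set Hx := ∑ j, τ j * (1 / pev (fk ctr rad j) p + Lam m * (1 / pev (fk ctr rad j) p ^ m j)) *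
          (2 * (p.1 - (ctr j).1)) with hHx
  set Hy := ∑ j, τ j * (1 / pev (fk ctr rad j) p + Lam m * (1 / pev (fk ctr rad j) p ^ m j)) *
          (2 * (p.2 - (ctr j).2)) with hHy
  have e1 : ∑ j ∈ Finset.univ.filter (fun k : Fin n => (k : ℕ) < r),
      (2 * (p.1 - (ctr j).1) * P + 2 * (p.2 - (ctr j).2) * Q) / pev (gpoly (ctr j)) p =
      Lx * P + Ly * Q := by
    rw [hLx, hLy, Finset.sum_mul, Finset.sum_mul, ← Finset.sum_add_distrib]
    exact Finset.sum_congr rfl fun j _ => by ring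
  have e2 : ∑ j, τ j * (1 / pev (fk ctr rad j) p + Lam m * (1 / pev (fk ctr rad j) p ^ m j)) *
      (2 * (p.1 - (ctr j).1) * P + 2 * (p.2 - (ctr j).2) * Q) = Hx * P + Hy * Q := by
    rw [hHx, hHy, Finset.sum_mul, Finset.sum_mul, ← Finset.sum_add_distrib]
    exact Finset.sum_congr rfl fun j _ => by ring
  have e3 : 2 * ∑ j ∈ Finset.univ.filter (fun k : Fin n => (k : ℕ) < r),
      angVel (ctr j) p (P, Q) = Lx * Q - Ly * P := by
    rw [hLx, hLy, Finset.sum_mul, Finset.sum_mul, ← Finset.sum_sub_distrib, Finset.mul_sum]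
    exact Finset.sum_congr rfl fun j _ => by
      unfold angVel
      ring
  rw [e1, e2, Finset.sum_sub_distrib, mul_sub, e3, ← Finset.sum_filter, Finset.sum_const,
    Finset.filter_filter, nsmul_eq_mul]
  linear_combination (Lx + Hx) * h1 + (Ly + Hy) * h2 + Ly * h1 - Lx * h2

end Lyapunov

section Trapping

variable (r : ℕ) (ctr : Fin n → ℝ × ℝ) {rad τ : Fin n → ℝ} {m : Fin n → ℕ}

theorem pev_gpoly_pos_of_mem_Ccir (hctr : ∀ j k, ctr j ∉ Ccir ctr rad k) {k : Fin n} {p : ℝ × ℝ}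
    (hp : p ∈ Ccir ctr rad k) (j : Fin n) : 0 < pev (gpoly (ctr j)) p := by
  rw [pev_gpoly]
  by_contra! h
  have h1 : p.1 - (ctr j).1 = 0 := by
    nlinarith [sq_nonneg (p.1 - (ctr j).1), sq_nonneg (p.2 - (ctr j).2)]
  have h2 : p.2 - (ctr j).2 = 0 := by
    nlinarith [sq_nonneg (p.1 - (ctr j).1), sq_nonneg (p.2 - (ctr j).2)]
  exact hctr j k ((Prod.ext (sub_eq_zero.1 h1) (sub_eq_zero.1 h2) : p = ctr j) ▸ hp)

theorem Lam_pos {k : Fin n} (hm : ∀ k, 1 ≤ m k) (hk : m k ≠ 1) : 0 < Lam m := by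
  have h1 : m k - 1 ≤ Lam m :=
    Finset.single_le_sum (f := fun k => m k - 1) (fun _ _ => Nat.zero_le _) (Finset.mem_univ k)
  have := hm k
  omega

theorem neg_one_pow_Mk_mul_angularSpeed_pos (hrad : ∀ k, 0 < rad k)
    (hdisj : ∀ j k, j ≠ k → Disjoint (Ccir ctr rad j) (Ccir ctr rad k))
    (hctr : ∀ j k, ctr j ∉ Ccir ctr rad k) (hτ : ∀ k, 0 < τ k) (hm : ∀ k, 1 ≤ m k)
    {k : Fin n} {p : ℝ × ℝ} (hp : p ∈ Ccir ctr rad k) :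
    0 < (-1) ^ Mk ctr rad m k * angularSpeed r ctr rad τ m k p := by
  have h1 := neg_one_pow_Mk_mul_prod_pos ctr hrad hdisj m hp
  have h2 : 0 < pev (Bpoly r ctr) p := by
    rw [Bpoly, pev_prod]
    exact Finset.prod_pos fun j _ => pev_gpoly_pos_of_mem_Ccir ctr hctr hp j
  have hp' : pev (fk ctr rad k) p = 0 := hp
  have h3 : 0 < pev (fk ctr rad k) p ^ (m k - 1) + (Lam m : ℝ) := by
    rw [hp']
    by_cases hk : m k = 1
    · rw [hk, pow_zero]
      positivity
    · rw [zero_pow (by have := hm k; omega), zero_add]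
      exact_mod_cast Lam_pos hm hk
  rw [angularSpeed]
  refine (mul_pos (mul_pos (mul_pos (mul_pos two_pos h2) (hτ k)) h1) h3).trans_eq ?_
  ring

theorem continuous_angularSpeed (k : Fin n) : Continuous (angularSpeed r ctr rad τ m k) := by
  have h := fun P : Poly2 => continuous_pev P
  unfold angularSpeed
  fun_prop

theorem angVel_of_mem_Ccir (hrad : ∀ k, 0 < rad k) (hm : ∀ k, 1 ≤ m k)
    {k : Fin n} {p : ℝ × ℝ} (hp : p ∈ Ccir ctr rad k) :
    angVel (ctr k) p (pev (PTm r ctr rad τ m) p, pev (QTm r ctr rad τ m) p) =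
      angularSpeed r ctr rad τ m k p := by
  rw [angVel, pev_PTm_of_mem_Ccir r ctr rad τ m hm k hp,
    pev_QTm_of_mem_Ccir r ctr rad τ m hm k hp, pev_gpoly]
  rw [mem_Ccir] at hp
  rw [hp, div_eq_iff (pow_pos (hrad k) 2).ne', ← hp]
  ring

theorem exists_good_strip (hrad : ∀ k, 0 < rad k)
    (hdisj : ∀ j k, j ≠ k → Disjoint (Ccir ctr rad j) (Ccir ctr rad k))
    (hctr : ∀ j k, ctr j ∉ Ccir ctr rad k) (hτ : ∀ k, 0 < τ k) (hm : ∀ k, 1 ≤ m k)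
    (k : Fin n) :
    ∃ δ > 0, ∃ K : ℝ, ∃ a > 0, ∃ b : ℝ, ∀ p, |pev (fk ctr rad k) p| < δ →
      (∀ j ≠ k, pev (fk ctr rad j) p ≠ 0) ∧ (∀ j, pev (gpoly (ctr j)) p ≠ 0) ∧
      (∀ j, 0 < refInner ctr rad k j p) ∧ |lyapunovRem ctr rad r τ m k p| ≤ K ∧
      a ≤ (-1) ^ Mk ctr rad m k *
        angVel (ctr k) p (pev (PTm r ctr rad τ m) p, pev (QTm r ctr rad τ m) p) ∧
      |(-1) ^ Mk ctr rad m k *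
        angVel (ctr k) p (pev (PTm r ctr rad τ m) p, pev (QTm r ctr rad τ m) p)| ≤ b := by
  have hc := isCompact_Ccir ctr (hrad k)
  have hF0 : ∀ p ∈ Ccir ctr rad k, ∀ j ≠ k, pev (fk ctr rad j) p ≠ 0 := fun p hp j hj h0 =>
    Set.disjoint_left.1 (hdisj j k hj) h0 hp
  have hg0 := fun p (hp : p ∈ Ccir ctr rad k) j => (pev_gpoly_pos_of_mem_Ccir ctr hctr hp j).ne'
  have hI0 := fun p (hp : p ∈ Ccir ctr rad k) j => refInner_pos ctr hctr j hp
  have h1 : ∀ᶠ p in 𝓝ˢ (Ccir ctr rad k), ∀ j ≠ k, pev (fk ctr rad j) p ≠ 0 := by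
    refine eventually_nhdsSet_iff_forall.2 fun p hp => ?_
    refine eventually_all.2 fun j => ?_
    by_cases hj : j = k
    · exact Eventually.of_forall fun _ h => absurd hj h
    · exact ((continuous_pev _).continuousAt.eventually_ne (hF0 p hp j hj)).mono fun _ h _ => h
  have h2 : ∀ᶠ p in 𝓝ˢ (Ccir ctr rad k), ∀ j, pev (gpoly (ctr j)) p ≠ 0 :=
    eventually_nhdsSet_iff_forall.2 fun p hp => eventually_all.2 fun j =>
      (continuous_pev _).continuousAt.eventually_ne (hg0 p hp j)
  have h3 : ∀ᶠ p in 𝓝ˢ (Ccir ctr rad k), ∀ j, 0 < refInner ctr rad k j p :=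
    eventually_nhdsSet_iff_forall.2 fun p hp => eventually_all.2 fun j =>
      (continuous_refInner ctr rad k j).continuousAt.eventually_const_lt (hI0 p hp j)
  obtain ⟨K, h4⟩ := hc.eventually_nhdsSet_abs_le fun p hp =>
    continuousAt_lyapunovRem ctr rad r τ m hm (hF0 p hp) (hg0 p hp) (hI0 p hp)
  have hcont : ∀ p ∈ Ccir ctr rad k, ContinuousAt (fun p => (-1) ^ Mk ctr rad m k *
      angVel (ctr k) p (pev (PTm r ctr rad τ m) p, pev (QTm r ctr rad τ m) p)) p := by
    intro p hp
    have h := fun P : Poly2 => continuous_pev P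
    unfold angVel
    refine ContinuousAt.mul continuousAt_const (ContinuousAt.div ?_ (h _).continuousAt
      (hg0 p hp k))
    fun_prop
  obtain ⟨a, ha, h5⟩ := hc.eventually_nhdsSet_pos_le hcont fun p hp => by
    rw [angVel_of_mem_Ccir r ctr hrad hm hp]
    exact neg_one_pow_Mk_mul_angularSpeed_pos r ctr hrad hdisj hctr hτ hm hp
  obtain ⟨b, h6⟩ := hc.eventually_nhdsSet_abs_le hcont
  obtain ⟨δ, hδ, hW⟩ := exists_strip_of_eventually ctr (hrad k)
    (h1.and (h2.and (h3.and (h4.and (h5.and h6)))))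
  exact ⟨δ, hδ, K, a, ha, b, hW⟩

/-- On the side of `C_k` where `s * f_k` is positive, solutions close to `C_k` converge to `C_k`
in the time direction determined by the divergence of `phi`. -/
theorem exists_trapping_nhd (hrad : ∀ k, 0 < rad k)
    (hdisj : ∀ j k, j ≠ k → Disjoint (Ccir ctr rad j) (Ccir ctr rad k))
    (hctr : ∀ j k, ctr j ∉ Ccir ctr rad k)
    (hprim : ∀ k, Primary ctr rad k ↔ (k : ℕ) < r)
    (hτ : ∀ k, 0 < τ k) (hm : ∀ k, 1 ≤ m k) (k : Fin n) {s q : ℝ} (hs : s ^ 2 = 1)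
    (hq : q ^ 2 = 1)
    (hphi : Tendsto (fun v => q * phi (τ k) (Lam m) (m k) (s * v)) (𝓝[>] 0) atTop) :
    ∃ U : Set (ℝ × ℝ), IsOpen U ∧ Ccir ctr rad k ⊆ U ∧ ∀ γ : ℝ → ℝ × ℝ,
      IsSolution (PTm r ctr rad τ m) (QTm r ctr rad τ m) γ → γ 0 ∈ U →
      0 < s * pev (fk ctr rad k) (γ 0) →
      Tendsto (fun t => Metric.infDist (γ (q * (-1) ^ Mk ctr rad m k * t)) (Ccir ctr rad k))
        atTop (𝓝 0) := by
  obtain ⟨δ, hδ, K, a, ha, b, hW⟩ := exists_good_strip r ctr hrad hdisj hctr hτ hm k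
  set ψ : ℝ → ℝ := fun v => q * phi (τ k) (Lam m) (m k) (s * v) with hψ
  set σ : ℝ := (-1) ^ Mk ctr rad m k
  set N : ℝ := ((Finset.univ.filter
    (fun j : Fin n => (j : ℕ) < r ∧ ctr j ∈ Ddisc ctr rad k)).card : ℝ) with hN
  have hNpos : 0 < N := by
    obtain ⟨j, hj, hjk⟩ := exists_primary_subset ctr hrad hdisj k
    rw [hN, Nat.cast_pos]
    refine Finset.card_pos.2 ⟨j, ?_⟩
    simp only [Finset.mem_filter, Finset.mem_univ, true_and]
    exact ⟨(hprim j).1 hj, ctr_mem_Ddisc_of_Ccir_subset ctr hjk⟩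
  have hs0 : s ≠ 0 := fun h => by simp [h] at hs
  have hsabs : |s| = 1 := by simpa [Real.sqrt_sq_eq_abs] using congrArg Real.sqrt hs
  have hlarge : ∀ K' : ℝ, ∃ η > 0, η ≤ δ ∧ ∀ v, 0 < v → v < η → K' < ψ v - K := by
    intro K'
    obtain ⟨η, hη, hη'⟩ := mem_nhdsGT_iff_exists_Ioo_subset.1
      (hphi.eventually (eventually_gt_atTop (K' + K)))
    exact ⟨min η δ, lt_min hη hδ, min_le_right _ _, fun v hv hv' =>
      lt_sub_iff_add_lt.2 (hη' ⟨hv, hv'.trans_le (min_le_left _ _)⟩)⟩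
  have hbdd : ∀ η > 0, ∃ K' : ℝ, ∀ v, η ≤ v → v < δ → ψ v + K ≤ K' := by
    intro η hη
    have hcont : ContinuousOn ψ (Icc η δ) := fun v hv => by
      have hv0 : s * v ≠ 0 := mul_ne_zero hs0 (hη.trans_le hv.1).ne'
      exact (ContinuousAt.mul continuousAt_const (ContinuousAt.comp (g := phi (τ k) (Lam m) (m k))
        (f := fun v => s * v) (hasDerivAt_phi (τ k) (Lam m) (hm k) hv0).continuousAt
        (by fun_prop))).continuousWithinAt
    obtain ⟨K', hK'⟩ := isCompact_Icc.exists_bound_of_continuousOn hcont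
    exact ⟨K' + K, fun v hv hv' =>
      add_le_add_left ((le_abs_self _).trans (hK' v ⟨hv, hv'.le⟩)) K⟩
  obtain ⟨M, hM⟩ := hbdd (δ / 2) (half_pos hδ)
  obtain ⟨η, hη, -, hη'⟩ := hlarge M
  refine ⟨{p | |pev (fk ctr rad k) p| < min (δ / 2) η},
    isOpen_lt (continuous_pev _).abs continuous_const, fun p hp => ?_, fun γ hγ h0 h0' => ?_⟩
  · have hp' : pev (fk ctr rad k) p = 0 := hp
    change |pev (fk ctr rad k) p| < _
    rw [hp', abs_zero]
    exact lt_min (half_pos hδ) hη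
  set v : ℝ → ℝ := fun t => s * pev (fk ctr rad k) (γ (q * σ * t)) with hv
  set g : ℝ → ℝ := fun t => q * lyapunov ctr rad r τ m k (γ (q * σ * t)) with hg
  have hγc : Continuous γ := continuous_iff_continuousAt.2 fun t => (hγ t).continuousAt
  have hvc : Continuous v :=
    continuous_const.mul ((continuous_pev _).comp (hγc.comp (by fun_prop)))
  have hvabs : ∀ t, 0 < v t → |pev (fk ctr rad k) (γ (q * σ * t))| = v t := fun t ht => by
    rw [← abs_of_pos ht, hv, abs_mul, hsabs, one_mul]
  have hgeq : ∀ t, g t = ψ (v t) + q * lyapunovRem ctr rad r τ m k (γ (q * σ * t)) := fun t => by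
    have : s * v t = pev (fk ctr rad k) (γ (q * σ * t)) := by
      simp only [hv]
      linear_combination pev (fk ctr rad k) (γ (q * σ * t)) * hs
    simp only [hg, hψ, lyapunov, this]
    ring
  have hqabs : |q| = 1 := by simpa [Real.sqrt_sq_eq_abs] using congrArg Real.sqrt hq
  have hgle : ∀ t, 0 < v t → v t < δ → ψ (v t) - K ≤ g t ∧ g t ≤ ψ (v t) + K := by
    intro t ht ht'
    have hK := (hW (γ (q * σ * t)) ((hvabs t ht).trans_lt ht')).2.2.2.1
    have h1 : |q * lyapunovRem ctr rad r τ m k (γ (q * σ * t))| ≤ K := by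
      rwa [abs_mul, hqabs, one_mul]
    rw [hgeq]
    exact ⟨by linarith [(abs_le.1 h1).1], by linarith [(abs_le.1 h1).2]⟩
  have hv0 : v 0 = s * pev (fk ctr rad k) (γ 0) := by simp [hv]
  have hmain : Tendsto v atTop (𝓝 0) := by
    refine tendsto_zero_of_trapped (g := g) (a := 2 * N * a) (b := 2 * N * b) (δ := δ)
      (δ' := min (δ / 2) η) (M := M) (by positivity) hvc (min_le_left _ _) ?_ ?_ ?_ ?_ ?_ ?_ ?_
    · intro t _ ht ht'
      obtain ⟨hF, hgp, hI, -, hA, hB⟩ := hW (γ (q * σ * t)) ((hvabs t ht).trans_lt ht')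
      have hF' : ∀ j, pev (fk ctr rad j) (γ (q * σ * t)) ≠ 0 := fun j => by
        by_cases hj : j = k
        · rw [hj, ← abs_pos, hvabs t ht]
          exact ht
        · exact hF j hj
      have hd := ((hasDerivAt_lyapunov ctr rad r τ m hm hγ hF' hgp hI).comp t
        ((hasDerivAt_id t).const_mul (q * σ))).const_mul q
      refine ⟨_, hd, ?_, ?_⟩
      · rw [mul_one, show ∀ x : ℝ, q * (2 * N * x * (q * σ)) = q ^ 2 * (2 * N * (σ * x)) by
          intro x; ring, hq, one_mul]
        exact mul_le_mul_of_nonneg_left hA (by positivity)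
      · rw [mul_one, show ∀ x : ℝ, q * (2 * N * x * (q * σ)) = q ^ 2 * (2 * N * (σ * x)) by
          intro x; ring, hq, one_mul]
        exact mul_le_mul_of_nonneg_left ((le_abs_self _).trans hB) (by positivity)
    · intro K'
      obtain ⟨η₁, hη₁, hδ₁, h⟩ := hlarge K'
      exact ⟨η₁, hη₁, fun t ht ht' =>
        (h _ ht ht').trans_le (hgle t ht (ht'.trans_le hδ₁)).1⟩
    · intro η₁ hη₁
      obtain ⟨K', h⟩ := hbdd η₁ hη₁
      exact ⟨K', fun t ht ht' => (hgle t (hη₁.trans_le ht) ht').2.trans (h _ ht ht')⟩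
    · exact fun t ht ht' => (hgle t ((half_pos hδ).trans_le ht) ht').2.trans (hM _ ht ht')
    · exact fun t ht ht' => (hη' _ ht (ht'.trans_le (min_le_right _ _))).trans_le
        (hgle t ht ((ht'.trans_le (min_le_left _ _)).trans (half_lt_self hδ))).1
    · rwa [hv0]
    · rw [hv0]
      refine (le_abs_self _).trans_lt ?_
      rw [abs_mul, hsabs, one_mul]
      exact h0
  have hlim : Tendsto (fun t => |v t| / rad k) atTop (𝓝 0) := by
    simpa using (hmain.abs).div_const (rad k)
  refine squeeze_zero (fun _ => Metric.infDist_nonneg) (fun t => ?_) hlim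
  refine (infDist_Ccir_le ctr (hrad k) _).trans_eq ?_
  simp only [hv, abs_mul, hsabs, one_mul]

end Trapping

section Orbits

theorem Function.Periodic.eq_of_tendsto_atTop {F : ℝ → ℝ} {T c : ℝ} (hF : Periodic F T)
    (hT : 0 < T) (h : Tendsto F atTop (𝓝 c)) (t : ℝ) : F t = c := by
  have h1 : Tendsto (fun i : ℕ => t + i * T) atTop atTop :=
    tendsto_atTop_add_const_left _ _ (tendsto_natCast_atTop_atTop.atTop_mul_const hT)
  have h2 := h.comp h1
  have h3 : (F ∘ fun i : ℕ => t + i * T) = fun _ => F t := funext fun i => hF.nat_mul i t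
  rw [h3] at h2
  exact tendsto_nhds_unique tendsto_const_nhds h2

theorem IsSolution.comp_add_const {P Q : Poly2} {γ : ℝ → ℝ × ℝ} (hγ : IsSolution P Q γ)
    (t₀ : ℝ) : IsSolution P Q fun t => γ (t + t₀) := fun t => (hγ (t + t₀)).comp_add_const t t₀

theorem IsSolution.continuous {P Q : Poly2} {γ : ℝ → ℝ × ℝ} (hγ : IsSolution P Q γ) :
    Continuous γ := continuous_iff_continuousAt.2 fun t => (hγ t).continuousAt

theorem IsSolution.isCompact_range {P Q : Poly2} {γ : ℝ → ℝ × ℝ} (hγ : IsSolution P Q γ)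
    {T : ℝ} (hT : 0 < T) (hper : Periodic γ T) : IsCompact (range γ) := by
  rw [← hper.image_Icc hT 0]
  exact isCompact_Icc.image hγ.continuous

theorem IsSolution.eq_of_isCompact {P Q : Poly2} {γ₁ γ₂ : ℝ → ℝ × ℝ} (h₁ : IsSolution P Q γ₁)
    (h₂ : IsSolution P Q γ₂) (hc₁ : IsCompact (range γ₁)) (hc₂ : IsCompact (range γ₂))
    (h : γ₁ 0 = γ₂ 0) : γ₁ = γ₂ := by
  have hv : ContDiff ℝ 1 fun p => (pev P p, pev Q p) := (contDiff_pev P).prodMk (contDiff_pev Q)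
  obtain ⟨K, hK⟩ := LocallyLipschitzOn.exists_lipschitzOnWith_of_compact (hc₁.union hc₂)
    (hv.locallyLipschitz.locallyLipschitzOn)
  exact ODE_solution_unique_univ (v := fun _ p => (pev P p, pev Q p))
    (s := fun _ => range γ₁ ∪ range γ₂) (t₀ := 0) (fun _ => hK)
    (fun t => ⟨h₁ t, Or.inl (mem_range_self t)⟩) (fun t => ⟨h₂ t, Or.inr (mem_range_self t)⟩) h

theorem IsPeriodicOrbit.eq_of_inter {P Q : Poly2} {S₁ S₂ : Set (ℝ × ℝ)}
    (h₁ : IsPeriodicOrbit P Q S₁) (h₂ : IsPeriodicOrbit P Q S₂) {p : ℝ × ℝ} (hp₁ : p ∈ S₁)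
    (hp₂ : p ∈ S₂) : S₁ = S₂ := by
  obtain ⟨γ₁, T₁, hT₁, hs₁, hper₁, -, rfl⟩ := h₁
  obtain ⟨γ₂, T₂, hT₂, hs₂, hper₂, -, rfl⟩ := h₂
  obtain ⟨t₁, rfl⟩ := hp₁
  obtain ⟨t₂, ht₂⟩ := hp₂
  have hr₁ : range (fun t => γ₁ (t + t₁)) = range γ₁ := (Equiv.addRight t₁).surjective.range_comp γ₁
  have hr₂ : range (fun t => γ₂ (t + t₂)) = range γ₂ := (Equiv.addRight t₂).surjective.range_comp γ₂
  have := (hs₁.comp_add_const t₁).eq_of_isCompact (hs₂.comp_add_const t₂)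
    (hr₁ ▸ hs₁.isCompact_range hT₁ hper₁) (hr₂ ▸ hs₂.isCompact_range hT₂ hper₂)
    (by simp only [zero_add, ht₂])
  rw [← hr₁, ← hr₂, this]

variable (r : ℕ) (ctr : Fin n → ℝ × ℝ) {rad τ : Fin n → ℝ} {m : Fin n → ℕ}

theorem isPeriodicOrbit_Ccir (hrad : ∀ k, 0 < rad k)
    (hdisj : ∀ j k, j ≠ k → Disjoint (Ccir ctr rad j) (Ccir ctr rad k))
    (hctr : ∀ j k, ctr j ∉ Ccir ctr rad k) (hτ : ∀ k, 0 < τ k) (hm : ∀ k, 1 ≤ m k)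
    (k : Fin n) :
    IsPeriodicOrbit (PTm r ctr rad τ m) (QTm r ctr rad τ m) (Ccir ctr rad k) := by
  set σ : ℝ := (-1) ^ Mk ctr rad m k with hσ
  have hσ' : σ = 1 ∨ σ = -1 := neg_one_pow_eq_or ℝ _
  have hcp : Periodic (circlePt ctr rad k) (2 * π) := fun θ => by simp [circlePt]
  obtain ⟨θ, T, hT, hθ, hθT, hsurj⟩ := exists_lift_solution
    (h := fun x => σ * angularSpeed r ctr rad τ m k (circlePt ctr rad k x))
    (continuous_const.mul ((continuous_angularSpeed r ctr k).comp (continuous_circlePt ctr rad k)))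
    (fun x => neg_one_pow_Mk_mul_angularSpeed_pos r ctr hrad hdisj hctr hτ hm
      (circlePt_mem ctr rad k x)) Real.two_pi_pos
    (fun x => by simp only [hcp x])
  have hrange : range (fun t => circlePt ctr rad k (θ (σ * t))) = Ccir ctr rad k := by
    have hσ0 : σ ≠ 0 := by rcases hσ' with h | h <;> simp [h]
    rw [← range_circlePt ctr (hrad k)]
    exact (hsurj.comp (mul_left_surjective₀ hσ0)).range_comp (circlePt ctr rad k)
  refine ⟨fun t => circlePt ctr rad k (θ (σ * t)), T, hT, fun t => ?_, fun t => ?_, ?_, hrange⟩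
  · rw [pev_PTm_of_mem_Ccir r ctr rad τ m hm k (circlePt_mem ctr rad k _),
      pev_QTm_of_mem_Ccir r ctr rad τ m hm k (circlePt_mem ctr rad k _)]
    set S := angularSpeed r ctr rad τ m k (circlePt ctr rad k (θ (σ * t))) with hS
    have h1 : HasDerivAt (fun t => θ (σ * t)) S t := by
      refine HasDerivAt.congr_deriv ((hθ (σ * t)).comp t ((hasDerivAt_id t).const_mul σ)) ?_
      rcases hσ' with h | h <;> simp [h, hS]
    have h2 := (((Real.hasDerivAt_cos _).comp t h1).const_mul (rad k)).const_add (ctr k).1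
    have h3 := (((Real.hasDerivAt_sin _).comp t h1).const_mul (rad k)).const_add (ctr k).2
    refine HasDerivAt.congr_deriv (h2.prodMk h3) ?_
    simp only [circlePt, add_sub_cancel_left]
    refine Prod.ext ?_ ?_ <;> simp only <;> ring
  · rcases hσ' with h | h
    · simp only [h, one_mul, hθT, hcp _]
    · have := hθT (-(t + T))
      rw [show -(t + T) + T = -t by ring] at this
      simp only [h, neg_mul, one_mul, this, hcp _]
  · by_contra! hconst
    have h1 : ∀ p ∈ Ccir ctr rad k, ∀ q ∈ Ccir ctr rad k, p = q := by
      rw [← hrange]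
      rintro _ ⟨t, rfl⟩ _ ⟨u, rfl⟩
      exact hconst t u
    have h2 := congrArg Prod.fst (h1 _ (circlePt_mem ctr rad k 0) _ (circlePt_mem ctr rad k π))
    simp only [circlePt, Real.cos_zero, Real.cos_pi] at h2
    linarith [hrad k]

end Orbits

/-- Lemma 2 of the paper. Each circle `C_k` is a limit cycle of `X_{Tm}`,
and its interior stability equals `(−1)^{m_k + M_k + 1}`: it is stable in the interior if
`m_k + M_k` is even and unstable in the interior if `m_k + M_k` is odd. -/
theorem limit_cycle_interior_stability_XTm
    (r : ℕ) (ctr : Fin n → ℝ × ℝ) (rad τ : Fin n → ℝ) (m : Fin n → ℕ)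
    (hn : 1 ≤ n) (hrn : r ≤ n) (hrad : ∀ k, 0 < rad k)
    (hdisj : ∀ j k, j ≠ k → Disjoint (Ccir ctr rad j) (Ccir ctr rad k))
    (hctr : ∀ j k, ctr j ∉ Ccir ctr rad k)
    (hprim : ∀ k, Primary ctr rad k ↔ (k : ℕ) < r)
    (hτ : ∀ k, 0 < τ k) (hm : ∀ k, 1 ≤ m k) (k : Fin n) :
    IsLimitCycle (PTm r ctr rad τ m) (QTm r ctr rad τ m) (Ccir ctr rad k) ∧
    (Even (m k + Mk ctr rad m k) →
      InteriorStable (PTm r ctr rad τ m) (QTm r ctr rad τ m)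
        (Ccir ctr rad k) (Ddisc ctr rad k)) ∧
    (Odd (m k + Mk ctr rad m k) →
      InteriorUnstable (PTm r ctr rad τ m) (QTm r ctr rad τ m)
        (Ccir ctr rad k) (Ddisc ctr rad k)) := by
  have hL' : m k ≠ 1 → (0 : ℝ) < Lam m := fun h => by exact_mod_cast Lam_pos hm h
  obtain ⟨U₁, hU₁, hCU₁, h₁⟩ := exists_trapping_nhd r ctr hrad hdisj hctr hprim hτ hm k
    (s := 1) (q := -1) (by norm_num) (by norm_num)
    (by simpa using tendsto_phi_pos (hτ k) (Nat.cast_nonneg (Lam m)) (m k))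
  obtain ⟨U₂, hU₂, hCU₂, h₂⟩ := exists_trapping_nhd r ctr hrad hdisj hctr hprim hτ hm k
    (s := -1) (q := (-1) ^ m k) (by norm_num) (by rw [← pow_mul, mul_comm, pow_mul]; norm_num)
    (by simpa using tendsto_phi_neg (hτ k) (hm k) (Nat.cast_nonneg (Lam m)) hL')
  have hinside : ∀ γ, IsSolution (PTm r ctr rad τ m) (QTm r ctr rad τ m) γ → γ 0 ∈ (Ddisc ctr rad k \ Ccir ctr rad k) ∩ U₂ →
      Tendsto (fun t => Metric.infDist (γ ((-1) ^ (m k + Mk ctr rad m k) * t)) (Ccir ctr rad k))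
        atTop (𝓝 0) := by
    intro γ hγ h0
    rw [pow_add]
    have := (pev_fk_neg_iff ctr).1 h0.1
    exact h₂ γ hγ h0.2 (by linarith)
  have hper := isPeriodicOrbit_Ccir r ctr hrad hdisj hctr hτ hm k
  refine ⟨⟨hper, U₁ ∩ U₂, hU₁.inter hU₂, subset_inter hCU₁ hCU₂, fun S hS hne => ?_⟩,
    fun he => ⟨U₂, hU₂, hCU₂, fun γ hγ h0 => ?_⟩, fun ho => ⟨U₂, hU₂, hCU₂, fun γ hγ h0 => ?_⟩⟩
  · rw [Set.disjoint_left]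
    intro p hpS hpU
    have hp0 : pev (fk ctr rad k) p ≠ 0 := fun h => hne (hS.eq_of_inter hper hpS h)
    obtain ⟨γ, T, hT, hγ, hγT, -, rfl⟩ := hS
    obtain ⟨t₀, rfl⟩ := hpS
    have hclosed := (isCompact_Ccir ctr (hrad k)).isClosed
    have hCne : (Ccir ctr rad k).Nonempty := ⟨_, circlePt_mem ctr rad k 0⟩
    have hcontra : ∀ c : ℝ, c = 1 ∨ c = -1 →
        ¬ Tendsto (fun t => Metric.infDist (γ (c * t + t₀)) (Ccir ctr rad k)) atTop (𝓝 0) := by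
      intro c hc hlim
      have hF : Periodic (fun t => Metric.infDist (γ (c * t + t₀)) (Ccir ctr rad k)) T := by
        intro t
        simp only
        rcases hc with rfl | rfl
        · rw [← hγT (1 * t + t₀)]
          ring_nf
        · rw [← hγT (-1 * (t + T) + t₀)]
          ring_nf
      have h0 := hF.eq_of_tendsto_atTop hT hlim 0
      simp only [mul_zero, zero_add] at h0
      exact hp0 ((hclosed.mem_iff_infDist_zero hCne).2 h0)
    have hsgn : ∀ i j : ℕ, ((-1 : ℝ) ^ i * (-1) ^ j = 1 ∨ (-1 : ℝ) ^ i * (-1) ^ j = -1) :=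
      fun i j => by
        rw [← pow_add]
        exact neg_one_pow_eq_or ℝ _
    have hγ' := hγ.comp_add_const t₀
    have hγ0 : γ (0 + t₀) = γ t₀ := by rw [zero_add]
    rcases hp0.lt_or_gt with hneg | hpos
    · refine hcontra _ (hsgn (m k) (Mk ctr rad m k)) (h₂ (fun t => γ (t + t₀)) hγ' ?_ ?_)
      · rw [hγ0]
        exact hpU.2
      · rw [hγ0]
        linarith
    · refine hcontra (-1 * (-1) ^ Mk ctr rad m k) ?_ (h₁ (fun t => γ (t + t₀)) hγ' ?_ ?_)
      · simpa only [pow_one] using hsgn 1 (Mk ctr rad m k)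
      · rw [hγ0]
        exact hpU.1
      · rw [hγ0]
        linarith
  · simpa [he.neg_one_pow] using hinside γ hγ h0
  · have h := hinside γ hγ h0
    rw [ho.neg_one_pow] at h
    simpa [Function.comp_def] using h.comp tendsto_neg_atBot_atTop
end
end

section
/- The polynomial V_T := A·B is an inverse integrating factor of the vector field X_T; that is, the identity P_T ∂(AB)/∂x + Q_T ∂(AB)/∂y = AB·(∂P_T/∂x + ∂Q_T/∂y) holds in ℝ[x,y]. Moreover, deg P_T ≤ 2(n+r) − 1 and deg Q_T ≤ 2(n+r) − 1. -/
open MvPolynomial Function Set Filter Real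
open scoped Classical

noncomputable section

variable {n : ℕ}

theorem pderiv_pderiv_comm {σ R : Type*} [CommRing R] (i j : σ) (p : MvPolynomial σ R) :
    pderiv i (pderiv j p) = pderiv j (pderiv i p) := by
  classical
  let D (k : σ) : Derivation R (MvPolynomial σ R) (MvPolynomial σ R) := pderiv k
  have h : ⁅D i, D j⁆ = 0 := by
    refine MvPolynomial.derivation_ext fun k => ?_
    simp [D, Derivation.commutator_apply, Pi.single_apply, apply_ite]
  have h' := DFunLike.congr_fun h p
  simpa [D, Derivation.commutator_apply, sub_eq_zero] using h'

theorem totalDegree_mul_pderiv_le {σ R : Type*} [CommSemiring R] (i : σ)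
    (p q : MvPolynomial σ R) :
    (p * pderiv i q).totalDegree ≤ p.totalDegree + q.totalDegree - 1 := by
  rcases eq_or_ne (pderiv i q) 0 with h | h
  · simp [h]
  have key : ∀ m ∈ (pderiv i q).support, (m.sum fun _ e => e) + 1 ≤ q.totalDegree := by
    intro m hm
    rw [mem_support_iff, coeff_pderiv] at hm
    have hq : m + Finsupp.single i 1 ∈ q.support := mem_support_iff.2 (left_ne_zero_of_mul hm)
    have hle := le_totalDegree hq
    rwa [Finsupp.sum_add_index' (fun _ => rfl) (fun _ _ _ => rfl),
      Finsupp.sum_single_index rfl] at hle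
  obtain ⟨m, hm⟩ := support_nonempty.2 h
  have hpos := key m hm
  have hdeg : (pderiv i q).totalDegree ≤ q.totalDegree - 1 :=
    Finset.sup_le fun m hm => by have := key m hm; omega
  have hmul := totalDegree_mul p (pderiv i q)
  omega

/-- The polynomial form of the equation `Δ (log B) = 0`. -/
def IsLogHarmonic (B : Poly2) : Prop :=
  B * (pderiv 0 (pderiv 0 B) + pderiv 1 (pderiv 1 B)) = pderiv 0 B ^ 2 + pderiv 1 B ^ 2

theorem IsLogHarmonic.mul {F G : Poly2} (hF : IsLogHarmonic F) (hG : IsLogHarmonic G) :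
    IsLogHarmonic (F * G) := by
  unfold IsLogHarmonic at *
  simp only [pderiv_mul, map_add]
  linear_combination G ^ 2 * hF + F ^ 2 * hG

theorem IsLogHarmonic.prod {ι : Type*} (s : Finset ι) {F : ι → Poly2}
    (hF : ∀ k ∈ s, IsLogHarmonic (F k)) : IsLogHarmonic (∏ k ∈ s, F k) :=
  Finset.prod_induction _ _ (fun _ _ => IsLogHarmonic.mul) (by simp [IsLogHarmonic]) hF

theorem isLogHarmonic_gpoly (c : ℝ × ℝ) : IsLogHarmonic (gpoly c) := by
  simp only [IsLogHarmonic, gpoly, pow_two, map_add, map_sub, pderiv_mul, pderiv_C, pderiv_X_self,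
    pderiv_X_of_ne (zero_ne_one' (Fin 2)), pderiv_X_of_ne (zero_ne_one' (Fin 2)).symm, map_zero,
    pderiv_one]
  ring

theorem isInvFactor_mul_of_isLogHarmonic {A B U W : Poly2} (hB : IsLogHarmonic B)
    (hUW : A * (pderiv 1 U - pderiv 0 W) = U * pderiv 1 A - W * pderiv 0 A) :
    IsInvFactor (A * (pderiv 0 B - pderiv 1 B) - B * W)
      (A * (pderiv 0 B + pderiv 1 B) + B * U) (A * B) := by
  have hcomm := pderiv_pderiv_comm 0 1 B
  unfold IsLogHarmonic at hB
  simp only [IsInvFactor, divPoly, pderiv_mul, map_add, map_sub]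
  linear_combination -A ^ 2 * hB - B ^ 2 * hUW + A ^ 2 * B * hcomm

section Circles

variable (ctr : Fin n → ℝ × ℝ) (rad τ : Fin n → ℝ)

theorem muk_mul_fk (k : Fin n) : muk ctr rad k * fk ctr rad k = Apoly ctr rad :=
  Finset.prod_erase_mul _ _ (Finset.mem_univ k)

theorem Apoly_mul_curl_sum :
    Apoly ctr rad *
        (pderiv 1 (∑ k, MvPolynomial.C (τ k) * muk ctr rad k * pderiv 0 (fk ctr rad k)) -
          pderiv 0 (∑ k, MvPolynomial.C (τ k) * muk ctr rad k * pderiv 1 (fk ctr rad k))) =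
      (∑ k, MvPolynomial.C (τ k) * muk ctr rad k * pderiv 0 (fk ctr rad k)) *
          pderiv 1 (Apoly ctr rad) -
        (∑ k, MvPolynomial.C (τ k) * muk ctr rad k * pderiv 1 (fk ctr rad k)) *
          pderiv 0 (Apoly ctr rad) := by
  simp only [map_sum, ← Finset.sum_sub_distrib, Finset.mul_sum, Finset.sum_mul]
  refine Finset.sum_congr rfl fun k _ => ?_
  rw [← muk_mul_fk ctr rad k]
  have hcomm := pderiv_pderiv_comm 0 1 (fk ctr rad k)
  simp only [pderiv_mul, pderiv_C]
  linear_combination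
    -MvPolynomial.C (τ k) * muk ctr rad k ^ 2 * fk ctr rad k * hcomm

theorem totalDegree_gpoly_le (c : ℝ × ℝ) : (gpoly c).totalDegree ≤ 2 := by
  have hX (i : Fin 2) (a : ℝ) : ((X i - MvPolynomial.C a : Poly2) ^ 2).totalDegree ≤ 2 := by
    refine (totalDegree_pow _ _).trans ?_
    have := totalDegree_sub_C_le (X i : Poly2) a
    rw [totalDegree_X] at this
    omega
  exact (totalDegree_add _ _).trans (max_le (hX 0 c.1) (hX 1 c.2))

theorem totalDegree_fk_le (k : Fin n) : (fk ctr rad k).totalDegree ≤ 2 :=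
  (totalDegree_sub_C_le _ _).trans (totalDegree_gpoly_le (ctr k))

theorem totalDegree_Apoly_le : (Apoly ctr rad).totalDegree ≤ 2 * n := by
  refine (totalDegree_finsetProd _ _).trans ?_
  refine (Finset.sum_le_card_nsmul _ _ 2 fun k _ => totalDegree_fk_le ctr rad k).trans ?_
  simp [mul_comm]

theorem totalDegree_Bpoly_le (r : ℕ) : (Bpoly r ctr).totalDegree ≤ 2 * r := by
  refine (totalDegree_finsetProd _ _).trans ?_
  refine (Finset.sum_le_card_nsmul _ _ 2 fun k _ => totalDegree_gpoly_le (ctr k)).trans ?_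
  rw [smul_eq_mul, Fin.card_filter_val_lt]
  have := min_le_right n r
  omega

theorem totalDegree_muk_le (k : Fin n) : (muk ctr rad k).totalDegree ≤ 2 * (n - 1) := by
  refine (totalDegree_finsetProd _ _).trans ?_
  refine (Finset.sum_le_card_nsmul _ _ 2 fun k _ => totalDegree_fk_le ctr rad k).trans ?_
  simp [mul_comm]

theorem totalDegree_Apoly_mul_pderiv_le (r : ℕ) (i : Fin 2) :
    (Apoly ctr rad * pderiv i (Bpoly r ctr)).totalDegree ≤ 2 * (n + r) - 1 := by
  have := totalDegree_mul_pderiv_le i (Apoly ctr rad) (Bpoly r ctr)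
  have := totalDegree_Apoly_le ctr rad
  have := totalDegree_Bpoly_le ctr r
  omega

theorem totalDegree_Bpoly_mul_sum_le (r : ℕ) (i : Fin 2) :
    (Bpoly r ctr *
      ∑ k, MvPolynomial.C (τ k) * muk ctr rad k * pderiv i (fk ctr rad k)).totalDegree ≤
        2 * (n + r) - 1 := by
  rw [Finset.mul_sum]
  refine totalDegree_finsetSum_le fun k _ => ?_
  rw [← mul_assoc]
  refine (totalDegree_mul_pderiv_le i _ _).trans ?_
  have := totalDegree_mul (Bpoly r ctr) (MvPolynomial.C (τ k) * muk ctr rad k)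
  have := totalDegree_mul (MvPolynomial.C (τ k)) (muk ctr rad k)
  have := totalDegree_C (σ := Fin 2) (τ k)
  have := totalDegree_Bpoly_le ctr r
  have := totalDegree_muk_le ctr rad k
  have := totalDegree_fk_le ctr rad k
  have := k.pos
  omega

end Circles

/-- `V_T = A·B` is a polynomial inverse integrating factor of `X_T`, and the
components `P_T, Q_T` have degree at most `2(n+r) − 1`. -/
theorem inverse_integrating_factor_XT
    (r : ℕ) (ctr : Fin n → ℝ × ℝ) (rad τ : Fin n → ℝ)
    (hn : 1 ≤ n) (hrn : r ≤ n) (hrad : ∀ k, 0 < rad k)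
    (hdisj : ∀ j k, j ≠ k → Disjoint (Ccir ctr rad j) (Ccir ctr rad k))
    (hctr : ∀ j k, ctr j ∉ Ccir ctr rad k)
    (hprim : ∀ k, Primary ctr rad k ↔ (k : ℕ) < r)
    (hτ : ∀ k, 0 < τ k) :
    IsInvFactor (PT r ctr rad τ) (QT r ctr rad τ) (Apoly ctr rad * Bpoly r ctr) ∧
    (PT r ctr rad τ).totalDegree ≤ 2 * (n + r) - 1 ∧
    (QT r ctr rad τ).totalDegree ≤ 2 * (n + r) - 1 := by
  refine ⟨isInvFactor_mul_of_isLogHarmonic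
    (IsLogHarmonic.prod _ fun k _ => isLogHarmonic_gpoly (ctr k))
    (Apoly_mul_curl_sum ctr rad τ), ?_, ?_⟩
  · rw [PT, mul_sub]
    exact (totalDegree_sub _ _).trans (max_le ((totalDegree_sub _ _).trans (max_le
      (totalDegree_Apoly_mul_pderiv_le ctr rad r 0) (totalDegree_Apoly_mul_pderiv_le ctr rad r 1)))
      (totalDegree_Bpoly_mul_sum_le ctr rad τ r 1))
  · rw [QT, mul_add]
    exact (totalDegree_add _ _).trans (max_le ((totalDegree_add _ _).trans (max_le
      (totalDegree_Apoly_mul_pderiv_le ctr rad r 0) (totalDegree_Apoly_mul_pderiv_le ctr rad r 1)))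
      (totalDegree_Bpoly_mul_sum_le ctr rad τ r 0))
end
end

section
/- For each k ∈ {1,…,n}, the polynomial f_k divides P_T ∂f_k/∂x + Q_T ∂f_k/∂y in ℝ[x,y]; in particular each circle C_k is an invariant algebraic curve of the vector field X_T. -/
open MvPolynomial Function Set Filter Real
open scoped Classical

noncomputable section

variable {n : ℕ}

/-- `f_k` divides `A`. -/
theorem fk_dvd_Apoly (ctr : Fin n → ℝ × ℝ) (rad : Fin n → ℝ) (k : Fin n) :
    fk ctr rad k ∣ Apoly ctr rad :=
  Finset.dvd_prod_of_mem _ (Finset.mem_univ k)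

/-- `f_k` divides `μ_j` for `j ≠ k`. -/
theorem fk_dvd_muk (ctr : Fin n → ℝ × ℝ) (rad : Fin n → ℝ) {j k : Fin n} (h : j ≠ k) :
    fk ctr rad k ∣ muk ctr rad j :=
  Finset.dvd_prod_of_mem _ (Finset.mem_erase.2 ⟨h.symm, Finset.mem_univ k⟩)

/-- Modulo `f_k`, the sum `Σ_j τ_j μ_j ∂_i f_j` reduces to its `k`-th term. -/
theorem fk_dvd_sum_sub (ctr : Fin n → ℝ × ℝ) (rad τ : Fin n → ℝ) (k : Fin n) (i : Fin 2) :
    fk ctr rad k ∣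
      ∑ j, MvPolynomial.C (τ j) * muk ctr rad j * pderiv i (fk ctr rad j) -
        MvPolynomial.C (τ k) * muk ctr rad k * pderiv i (fk ctr rad k) := by
  rw [← Finset.add_sum_erase _ _ (Finset.mem_univ k), add_sub_cancel_left]
  exact Finset.dvd_sum fun j hj =>
    ((fk_dvd_muk ctr rad (Finset.ne_of_mem_erase hj)).mul_left _).mul_right _

/-- For each `k`, the polynomial `f_k` divides `P_T ∂f_k/∂x + Q_T ∂f_k/∂y`
in `ℝ[x,y]`; in particular each circle `C_k` is an invariant algebraic curve of `X_T`. -/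
theorem invariant_algebraic_curves_XT
    (r : ℕ) (ctr : Fin n → ℝ × ℝ) (rad τ : Fin n → ℝ)
    (hn : 1 ≤ n) (hrn : r ≤ n) (hrad : ∀ k, 0 < rad k)
    (hdisj : ∀ j k, j ≠ k → Disjoint (Ccir ctr rad j) (Ccir ctr rad k))
    (hctr : ∀ j k, ctr j ∉ Ccir ctr rad k)
    (hprim : ∀ k, Primary ctr rad k ↔ (k : ℕ) < r)
    (hτ : ∀ k, 0 < τ k) (k : Fin n) :
    fk ctr rad k ∣
      PT r ctr rad τ * pderiv 0 (fk ctr rad k) + QT r ctr rad τ * pderiv 1 (fk ctr rad k) := by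
  obtain ⟨a, ha⟩ := fk_dvd_Apoly ctr rad k
  obtain ⟨s, hs⟩ := fk_dvd_sum_sub ctr rad τ k 0
  obtain ⟨t, ht⟩ := fk_dvd_sum_sub ctr rad τ k 1
  rw [sub_eq_iff_eq_add] at hs ht
  rw [PT, QT, hs, ht, ha]
  refine ⟨a * ((pderiv 0 (Bpoly r ctr) - pderiv 1 (Bpoly r ctr)) * pderiv 0 (fk ctr rad k) +
      (pderiv 0 (Bpoly r ctr) + pderiv 1 (Bpoly r ctr)) * pderiv 1 (fk ctr rad k)) +
    Bpoly r ctr * (s * pderiv 1 (fk ctr rad k) - t * pderiv 0 (fk ctr rad k)), ?_⟩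
  ring
end
end
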